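/- Spherical case of the surface evolution equation with general reference center: Let r₀ ≡ 1 and let (r,c) solve ∂_t r + A₁[r] ∂_θ r = A₂[r] with r(0,·) = 1, where the reference-center velocity ċ(t) = (0,0,ċ₃(t)) is a prescribed continuous function with ċ ≠ v* = −(4/15)e₃ and c(0) = 0; set c*(t) = v* t, and let T > 0 be the maximal time such that |c(t) − c*(t)| ≤ 1 on [0,T]. Then for all t ∈ [0,T] and θ ∈ [0,π], r(t,θ) = −(c−c*)₃(t) cos θ + √(1 − (c−c*)₃(t)² sin² θ), and |c(t) + r(t,θ) e(θ,0) − c*(t)| = 1. In other words, the droplet boundary { c(t) + r(t,θ) e(θ,φ) : (θ,φ) ∈ [0,π]×[0,2π] } equals the sphere ∂B(c*(t),1) for all t ∈ [0,T]. -/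

import Mathlib

/- Spherical case of the surface evolution equation with a general reference center: if r₀ ≡ 1
   and (r,c) solves ∂_t r + A₁[r] ∂_θ r = A₂[r] with prescribed continuous center velocity
   ċ = (0,0,ċ₃) ≠ v* = −(4/15)e₃, c(0) = 0, and |c(t) − c*(t)| ≤ 1 on [0,T] with c*(t) = v*t,
   then r(t,θ) = −(c−c*)₃ cos θ + √(1 − (c−c*)₃² sin²θ), the point c(t) + r(t,θ)e(θ,0) lies on
   the unit sphere centered at c*(t), and the droplet boundary equals ∂B(c*(t),1). -/

noncomputable section
open MeasureTheory Real Set Filter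

def V3 (a b c : ℝ) : EuclideanSpace ℝ (Fin 3) := (WithLp.equiv 2 (Fin 3 → ℝ)).symm ![a, b, c]

def e3 : EuclideanSpace ℝ (Fin 3) := V3 0 0 1

/-- Spherical parametrization `e(θ,φ) = (cos φ sin θ, sin φ sin θ, cos θ)`. -/
def eSph (θ φ : ℝ) : EuclideanSpace ℝ (Fin 3) :=
  V3 (Real.cos φ * Real.sin θ) (Real.sin φ * Real.sin θ) (Real.cos θ)

/-- `β[r](θ,θ̄,φ)`. -/
def betaR (r : ℝ → ℝ) (θ θb φ : ℝ) : ℝ :=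
  Real.sqrt (r θ ^ 2 + r θb ^ 2 -
    2 * r θ * r θb * (Real.sin θ * Real.sin θb * Real.cos φ + Real.cos θ * Real.cos θb))

/-- The nonlocal transport coefficient `A₁[r]` (with reference-center velocity `c3dot`). -/
def A1op (r : ℝ → ℝ) (c3dot : ℝ) (θ : ℝ) : ℝ :=
  -(1 / (8 * π * r θ)) *
    (∫ φ in (0:ℝ)..(2 * π), ∫ θb in (0:ℝ)..π,
      (r θb * Real.sin θb - deriv r θb * Real.cos θb) / betaR r θ θb φ *
        (r θb * Real.sin θb) *
        (r θ * Real.cos φ -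
          r θb * (Real.cos θb * Real.cos θ * Real.cos φ + Real.sin θb * Real.sin θ)))
  + c3dot * Real.sin θ / r θ

/-- The nonlocal source term `A₂[r]` (with reference-center velocity `c3dot`). -/
def A2op (r : ℝ → ℝ) (c3dot : ℝ) (θ : ℝ) : ℝ :=
  -(1 / (8 * π)) *
    (∫ φ in (0:ℝ)..(2 * π), ∫ θb in (0:ℝ)..π,
      (r θb * Real.sin θb - deriv r θb * Real.cos θb) / betaR r θ θb φ *
        (r θb * Real.sin θb) *
        (-(r θb) * Real.sin θ * Real.cos θb * Real.cos φ + r θb * Real.cos θ * Real.sin θb))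
  - c3dot * Real.cos θ

/-- Rotation of the (z,x) plane. -/
def rot2 (a : ℝ) : ℝ × ℝ →ₗ[ℝ] ℝ × ℝ :=
  Matrix.toLin (Module.Basis.finTwoProd ℝ) (Module.Basis.finTwoProd ℝ) !![cos a, -sin a; sin a, cos a]

lemma rot2_apply (a : ℝ) (p : ℝ × ℝ) :
    rot2 a p = (cos a * p.1 - sin a * p.2, sin a * p.1 + cos a * p.2) := by
  simp [rot2, Matrix.toLin_finTwoProd_apply, sub_eq_add_neg]

lemma rot2_det (a : ℝ) : LinearMap.det (rot2 a) = 1 := by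
  rw [rot2, LinearMap.det_toLin, Matrix.det_fin_two_of]
  nlinarith [sin_sq_add_cos_sq a]

lemma rot2_mp (a : ℝ) : MeasurePreserving (rot2 a) volume volume := by
  refine ⟨(rot2 a).continuous_of_finiteDimensional.measurable, ?_⟩
  rw [Measure.map_linearMap_addHaar_eq_smul_addHaar _ (by rw [rot2_det]; norm_num), rot2_det]
  simp

def rot3 (a : ℝ) (p : ℝ × ℝ × ℝ) : ℝ × ℝ × ℝ :=
  (cos a * p.1 - sin a * p.2.1, sin a * p.1 + cos a * p.2.1, p.2.2)

lemma rot3_meas (a : ℝ) : Measurable (rot3 a) := by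
  unfold rot3; fun_prop

lemma rot3_mp (a : ℝ) : MeasurePreserving (rot3 a) volume volume := by
  have h1 : MeasurePreserving (MeasurableEquiv.prodAssoc : (ℝ × ℝ) × ℝ ≃ᵐ ℝ × ℝ × ℝ) volume volume :=
    measurePreserving_prodAssoc volume volume volume
  have h2 : MeasurePreserving (Prod.map (rot2 a) (id : ℝ → ℝ)) volume volume :=
    (rot2_mp a).prod (MeasurePreserving.id volume)
  have := (h1.comp h2).comp (h1.symm MeasurableEquiv.prodAssoc)
  suffices hfun : rot3 a = (MeasurableEquiv.prodAssoc ∘ Prod.map (rot2 a) id) ∘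
      (MeasurableEquiv.prodAssoc : (ℝ × ℝ) × ℝ ≃ᵐ ℝ × ℝ × ℝ).symm by
    rw [hfun]; exact this
  funext p
  have : (MeasurableEquiv.prodAssoc (Prod.map (rot2 a) id ((p.1, p.2.1), p.2.2)) : ℝ × ℝ × ℝ) = rot3 a p := by
    simp only [Prod.map, rot2_apply]
    rfl
  exact this.symm

lemma sph_lintegral (f : ℝ × ℝ × ℝ → ENNReal) (hf : Measurable f) :
    ∫⁻ p, f p = ∫⁻ φ in Ioo (-π) π, ∫⁻ q in Ioi (0:ℝ) ×ˢ Ioo 0 π,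
      ENNReal.ofReal (q.1 ^ 2 * sin q.2) *
        f (q.1 * cos q.2, q.1 * sin q.2 * cos φ, q.1 * sin q.2 * sin φ) := by
  have e1 : ∫⁻ p, f p = ∫⁻ z, ∫⁻ q, f (z, q) := by
    rw [Measure.volume_eq_prod, lintegral_prod _ hf.aemeasurable]
  have e2 : ∀ z, ∫⁻ q, f (z, q) = ∫⁻ φ in Ioo (-π) π, ∫⁻ ρ in Ioi (0:ℝ),
      ENNReal.ofReal ρ * f (z, ρ * cos φ, ρ * sin φ) := by
    intro z
    rw [← lintegral_comp_polarCoord_symm]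
    have : polarCoord.target = Ioi (0:ℝ) ×ˢ Ioo (-π) π := rfl
    rw [this, Measure.volume_eq_prod, ← Measure.prod_restrict, lintegral_prod_symm]
    · rfl
    · apply Measurable.aemeasurable
      simp only [polarCoord_symm_apply, smul_eq_mul]
      fun_prop
  rw [e1]
  simp_rw [e2]
  rw [lintegral_lintegral_swap]
  · apply lintegral_congr
    intro φ
    have e3 : ∫⁻ z, ∫⁻ ρ in Ioi (0:ℝ), ENNReal.ofReal ρ * f (z, ρ * cos φ, ρ * sin φ)
        = ∫⁻ p : ℝ × ℝ, (univ ×ˢ Ioi (0:ℝ)).indicator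
          (fun p => ENNReal.ofReal p.2 * f (p.1, p.2 * cos φ, p.2 * sin φ)) p := by
      rw [lintegral_indicator (MeasurableSet.univ.prod measurableSet_Ioi), Measure.volume_eq_prod,
        ← Measure.prod_restrict, lintegral_prod]
      · simp
      · apply Measurable.aemeasurable
        fun_prop
    rw [e3, ← lintegral_comp_polarCoord_symm]
    have : polarCoord.target = Ioi (0:ℝ) ×ˢ Ioo (-π) π := rfl
    rw [this, ← lintegral_indicator (measurableSet_Ioi.prod measurableSet_Ioo),
      ← lintegral_indicator (measurableSet_Ioi.prod measurableSet_Ioo)]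
    apply lintegral_congr
    rintro ⟨s, θ⟩
    by_cases hs : 0 < s
    · by_cases hθ : θ ∈ Ioo 0 π
      · have hsin : 0 < sin θ := sin_pos_of_mem_Ioo hθ
        rw [indicator_of_mem (s := Ioi (0:ℝ) ×ˢ Ioo 0 π) (by exact ⟨hs, hθ⟩),
          indicator_of_mem (s := Ioi (0:ℝ) ×ˢ Ioo (-π) π)
            (by exact ⟨hs, by constructor <;> linarith [hθ.1, hθ.2, pi_pos]⟩)]
        · simp only [polarCoord_symm_apply]
          rw [indicator_of_mem (by exact ⟨mem_univ _, mul_pos hs hsin⟩)]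
          rw [smul_eq_mul, ← mul_assoc, ← ENNReal.ofReal_mul hs.le]
          simp only
          congr 2
          ring
      · rw [indicator_of_notMem (s := Ioi (0:ℝ) ×ˢ Ioo 0 π) (by simp; intro _; simpa using hθ)]
        by_cases h2 : θ ∈ Ioo (-π) π
        · rw [indicator_of_mem (by exact ⟨hs, h2⟩)]
          simp only [polarCoord_symm_apply]
          rw [indicator_of_notMem, smul_zero]
          simp only [mem_prod, mem_univ, true_and, mem_Ioi, not_lt]
          have : θ ≤ 0 := by
            by_contra h
            exact hθ ⟨by linarith, h2.2⟩
          have := sin_nonpos_of_nonpos_of_neg_pi_le this h2.1.le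
          exact mul_nonpos_of_nonneg_of_nonpos hs.le this
        · rw [indicator_of_notMem (by simp; intro _; simpa using h2)]
    · rw [indicator_of_notMem (by simp; intro h; exact absurd h hs), indicator_of_notMem (by simp; intro h; exact absurd h hs)]
  · apply Measurable.aemeasurable
    apply Measurable.lintegral_prod_right'  (f := fun q : (ℝ × ℝ) × ℝ => ENNReal.ofReal q.2 * f (q.1.1, q.2 * cos q.1.2, q.2 * sin q.1.2))
    fun_prop

/-- sphere embedding, `q = (φ,θ)`, coordinates (z,x,y). -/
def emb (q : ℝ × ℝ) : ℝ × ℝ × ℝ := (cos q.2, sin q.2 * cos q.1, sin q.2 * sin q.1)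

lemma emb_meas : Measurable emb := by unfold emb; fun_prop

lemma sph_hom (h : ℝ × ℝ × ℝ → ENNReal) (hh : Measurable h) :
    ∫⁻ p : ℝ × ℝ × ℝ, {p : ℝ × ℝ × ℝ | p.1 ^ 2 + p.2.1 ^ 2 + p.2.2 ^ 2 < 1}.indicator
      (fun p => h ((√(p.1 ^ 2 + p.2.1 ^ 2 + p.2.2 ^ 2))⁻¹ • p)) p =
    (∫⁻ s in Ioo (0:ℝ) 1, ENNReal.ofReal (s ^ 2)) *
      ∫⁻ φ in Ioo (-π) π, ∫⁻ θ in Ioo 0 π, ENNReal.ofReal (sin θ) * h (emb (φ, θ)) := by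
  have hS : MeasurableSet {p : ℝ × ℝ × ℝ | p.1 ^ 2 + p.2.1 ^ 2 + p.2.2 ^ 2 < 1} :=
    measurableSet_lt (by fun_prop) (by fun_prop)
  rw [sph_lintegral _ ((by fun_prop : Measurable _).indicator hS)]
  rw [← lintegral_const_mul]
  · apply lintegral_congr
    intro φ
    rw [Measure.volume_eq_prod, ← Measure.prod_restrict, ← lintegral_prod_mul
      (f := fun s => ENNReal.ofReal (s ^ 2)) (g := fun θ => ENNReal.ofReal (sin θ) * h (emb (φ, θ)))]
    rotate_left
    · fun_prop
    · apply Measurable.aemeasurable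
      have := emb_meas
      fun_prop
    rw [Measure.prod_restrict, Measure.prod_restrict,
      ← lintegral_indicator (measurableSet_Ioi.prod measurableSet_Ioo),
      ← lintegral_indicator (measurableSet_Ioo.prod measurableSet_Ioo)]
    apply lintegral_congr
    rintro ⟨s, θ⟩
    by_cases hs : 0 < s
    · by_cases hθ : θ ∈ Ioo 0 π
      · have hn : (s * cos θ) ^ 2 + (s * sin θ * cos φ) ^ 2 + (s * sin θ * sin φ) ^ 2 = s ^ 2 := by
          have h1 := sin_sq_add_cos_sq θ
          have h2 := sin_sq_add_cos_sq φ
          linear_combination s^2 * sin θ ^2 * h2 + s ^ 2 * h1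
        rw [indicator_of_mem (by exact ⟨hs, hθ⟩)]
        by_cases h1 : s < 1
        · rw [indicator_of_mem (by simp only [mem_ofPred_eq]; rw [hn]; nlinarith), indicator_of_mem (by exact ⟨⟨hs, h1⟩, hθ⟩)]
          simp only
          rw [hn, sqrt_sq hs.le, ENNReal.ofReal_mul (by positivity), mul_assoc]
          congr 3
          simp only [emb, Prod.smul_mk, smul_eq_mul]
          ext <;> simp <;> field_simp
        · rw [indicator_of_notMem (by simp only [mem_ofPred_eq]; rw [hn]; nlinarith), indicator_of_notMem (by simp; intro _ h; exact absurd h h1), mul_zero]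
      · rw [indicator_of_notMem (by simp; intro _; simpa using hθ), indicator_of_notMem (by simp; intro _ _; simpa using hθ)]
    · rw [indicator_of_notMem (by simp; intro h; exact absurd h hs), indicator_of_notMem (by simp; intro h; exact absurd h hs)]
  · have := emb_meas
    apply Measurable.lintegral_prod_right' (f := fun q : ℝ × ℝ => ENNReal.ofReal (sin q.2) * h (emb (q.1, q.2)))
    fun_prop

lemma sph_rot_lintegral (a : ℝ) (h : ℝ × ℝ × ℝ → ENNReal) (hh : Measurable h) :
    ∫⁻ φ in Ioo (-π) π, ∫⁻ θ in Ioo 0 π, ENNReal.ofReal (sin θ) * h (rot3 a (emb (φ, θ))) =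
    ∫⁻ φ in Ioo (-π) π, ∫⁻ θ in Ioo 0 π, ENNReal.ofReal (sin θ) * h (emb (φ, θ)) := by
  have hS : MeasurableSet {p : ℝ × ℝ × ℝ | p.1 ^ 2 + p.2.1 ^ 2 + p.2.2 ^ 2 < 1} :=
    measurableSet_lt (by fun_prop) (by fun_prop)
  have h1 := sph_hom h hh
  have h2 := sph_hom (fun p => h (rot3 a p)) (hh.comp (rot3_meas a))
  have hκ0 : (∫⁻ s in Ioo (0:ℝ) 1, ENNReal.ofReal (s ^ 2)) ≠ 0 := by
    rw [← pos_iff_ne_zero, setLIntegral_pos_iff (by fun_prop)]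
    have : Function.support (fun s : ℝ => ENNReal.ofReal (s ^ 2)) ∩ Ioo 0 1 = Ioo 0 1 := by
      ext s; simp; intro h _; exact h.ne'
    rw [this]; simp
  have hκ1 : (∫⁻ s in Ioo (0:ℝ) 1, ENNReal.ofReal (s ^ 2)) ≠ ⊤ := by
    refine ne_top_of_le_ne_top (b := ∫⁻ s in Ioo (0:ℝ) 1, 1) (by simp) ?_
    apply setLIntegral_mono measurable_const
    intro s hs
    simp only [ENNReal.ofReal_le_one]
    nlinarith [hs.1, hs.2]
  have hm : Measurable (fun p : ℝ × ℝ × ℝ => h ((√(p.1 ^ 2 + p.2.1 ^ 2 + p.2.2 ^ 2))⁻¹ • p)) := by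
    fun_prop
  rw [← ENNReal.mul_right_inj hκ0 hκ1, ← h1, ← h2,
    ← (rot3_mp a).lintegral_comp (hm.indicator hS)]
  apply lintegral_congr
  intro p
  have hn : (rot3 a p).1 ^ 2 + (rot3 a p).2.1 ^ 2 + (rot3 a p).2.2 ^ 2 = p.1 ^ 2 + p.2.1 ^ 2 + p.2.2 ^ 2 := by
    simp only [rot3]
    have h1 := sin_sq_add_cos_sq a
    linear_combination (p.1 ^ 2 + p.2.1 ^ 2) * h1
  simp only [indicator, mem_ofPred_eq]
  rw [hn]
  congr 2
  simp only [rot3]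
  ext <;> simp <;> ring

/-- surface measure in the coordinates (φ,θ) -/
def nuS : Measure (ℝ × ℝ) :=
  ((volume.restrict (Ioo (-π) π)).prod (volume.restrict (Ioo 0 π))).withDensity
    (fun q => ENNReal.ofReal (sin q.2))

lemma nuS_lintegral (h : ℝ × ℝ → ENNReal) (hh : Measurable h) :
    ∫⁻ q, h q ∂nuS = ∫⁻ φ in Ioo (-π) π, ∫⁻ θ in Ioo 0 π, ENNReal.ofReal (sin θ) * h (φ, θ) := by
  rw [nuS, lintegral_withDensity_eq_lintegral_mul _ (by fun_prop) hh, lintegral_prod]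
  · rfl
  · apply Measurable.aemeasurable
    fun_prop

lemma nuS_rot (a : ℝ) : Measure.map (fun q => rot3 a (emb q)) nuS = Measure.map emb nuS := by
  have m1 : Measurable (fun q => rot3 a (emb q)) := (rot3_meas a).comp emb_meas
  ext s hs
  rw [← lintegral_indicator_one hs, ← lintegral_indicator_one hs,
    lintegral_map (measurable_one.indicator hs) m1,
    lintegral_map (measurable_one.indicator hs) emb_meas,
    nuS_lintegral (fun q => s.indicator 1 (rot3 a (emb q))) ((measurable_one.indicator hs).comp m1),
    nuS_lintegral (fun q => s.indicator 1 (emb q)) ((measurable_one.indicator hs).comp emb_meas)]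
  exact sph_rot_lintegral a _ (measurable_one.indicator hs)

lemma nuS_rot_integral (a : ℝ) (F : ℝ × ℝ × ℝ → ℝ) (hF : Measurable F) :
    ∫ q, F (emb q) ∂nuS = ∫ q, F (rot3 a (emb q)) ∂nuS := by
  have m1 : Measurable (fun q => rot3 a (emb q)) := (rot3_meas a).comp emb_meas
  rw [← integral_map emb_meas.aemeasurable hF.aestronglyMeasurable, ← nuS_rot a,
    integral_map m1.aemeasurable hF.aestronglyMeasurable]


lemma nuS_integral (G : ℝ × ℝ → ℝ) (hG : Measurable G) (C : ℝ) (hC : ∀ q, |G q| ≤ C) :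
    ∫ q, G q ∂nuS = ∫ φ in (-π)..π, ∫ θ in (0:ℝ)..π, sin θ * G (φ, θ) := by
  have h0 : (0:ℝ) ≤ π := pi_pos.le
  have h1 : -π ≤ π := by linarith [pi_pos]
  rw [nuS, integral_withDensity_eq_integral_toReal_smul (by fun_prop) (by simp)]
  have hint : Integrable (fun q : ℝ × ℝ => (ENNReal.ofReal (sin q.2)).toReal • G q)
      ((volume.restrict (Ioo (-π) π)).prod (volume.restrict (Ioo 0 π))) := by
    refine Integrable.of_bound (C := C) ?_ ?_
    · apply Measurable.aestronglyMeasurable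
      fun_prop
    · refine ae_of_all _ fun q => ?_
      rw [norm_smul]
      have : ‖(ENNReal.ofReal (sin q.2)).toReal‖ ≤ 1 := by
        rw [norm_eq_abs, abs_of_nonneg ENNReal.toReal_nonneg, ENNReal.toReal_ofReal']
        exact max_le (sin_le_one _) zero_le_one
      calc _ ≤ 1 * C := mul_le_mul this (hC q) (abs_nonneg _) zero_le_one
        _ = C := one_mul _
  rw [integral_prod _ hint]
  rw [intervalIntegral.integral_of_le h1, integral_Ioc_eq_integral_Ioo]
  apply integral_congr_ae
  refine ae_of_all _ fun φ => ?_
  simp only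
  rw [intervalIntegral.integral_of_le h0, integral_Ioc_eq_integral_Ioo]
  apply setIntegral_congr_fun measurableSet_Ioo
  intro θ hθ
  simp only [smul_eq_mul]
  rw [ENNReal.toReal_ofReal (sin_pos_of_mem_Ioo hθ).le]

def Fs (a b α : ℝ) (p : ℝ × ℝ × ℝ) : ℝ :=
  (a * (sin α * p.2.1 - 1 + p.1 ^ 2) + b * p.2.1 * (cos α - p.1)) /
    √(2 - 2 * (sin α * p.2.1 + cos α * p.1))

lemma Fs_bound (a b α : ℝ) (p : ℝ × ℝ × ℝ) (hp : p.1 ^ 2 + p.2.1 ^ 2 + p.2.2 ^ 2 = 1) :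
    |Fs a b α p| ≤ 2 * |a| + |b| := by
  obtain ⟨z, x, y⟩ := p
  simp only [Fs] at *
  have hD : 2 - 2 * (sin α * x + cos α * z) = (sin α - x) ^ 2 + y ^ 2 + (cos α - z) ^ 2 := by
    linear_combination - (sin_sq_add_cos_sq α) - hp
  rw [hD]
  set D := (sin α - x) ^ 2 + y ^ 2 + (cos α - z) ^ 2
  have h1 : |sin α - x| ≤ √D := abs_le_sqrt (by simp only [D]; nlinarith [sq_nonneg y, sq_nonneg (cos α - z)])
  have h2 : |y| ≤ √D := abs_le_sqrt (by simp only [D]; nlinarith [sq_nonneg (sin α - x), sq_nonneg (cos α - z)])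
  have h3 : |cos α - z| ≤ √D := abs_le_sqrt (by simp only [D]; nlinarith [sq_nonneg (sin α - x), sq_nonneg y])
  have hx : |x| ≤ 1 := abs_le_one_iff_mul_self_le_one.2 (by nlinarith [sq_nonneg z, sq_nonneg y])
  have hy : |y| ≤ 1 := abs_le_one_iff_mul_self_le_one.2 (by nlinarith [sq_nonneg z, sq_nonneg x])
  have hN : a * (sin α * x - 1 + z ^ 2) + b * x * (cos α - z)
      = a * (x * (sin α - x) - y * y) + b * (x * (cos α - z)) := by
    linear_combination a * hp
  rw [hN, abs_div, abs_of_nonneg (sqrt_nonneg D)]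
  apply div_le_of_le_mul₀ (sqrt_nonneg _) (by positivity)
  have k1 : |x * (sin α - x)| ≤ √D := by
    rw [abs_mul]; nlinarith [abs_nonneg x, abs_nonneg (sin α - x)]
  have k2 : |y * y| ≤ √D := by
    rw [abs_mul]; nlinarith [abs_nonneg y]
  have k3 : |x * (cos α - z)| ≤ √D := by
    rw [abs_mul]; nlinarith [abs_nonneg x, abs_nonneg (cos α - z)]
  calc _ ≤ |a * (x * (sin α - x) - y * y)| + |b * (x * (cos α - z))| := abs_add_le _ _
    _ = |a| * |x * (sin α - x) - y * y| + |b| * |x * (cos α - z)| := by rw [abs_mul, abs_mul]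
    _ ≤ |a| * (√D + √D) + |b| * √D := by
        gcongr
        exact (abs_sub _ _).trans (add_le_add k1 k2)
    _ = _ := by ring

lemma emb_unit (q : ℝ × ℝ) : (emb q).1 ^ 2 + (emb q).2.1 ^ 2 + (emb q).2.2 ^ 2 = 1 := by
  simp only [emb]
  linear_combination sin q.2 ^ 2 * sin_sq_add_cos_sq q.1 + sin_sq_add_cos_sq q.2

lemma rot_unit (α : ℝ) (p : ℝ × ℝ × ℝ) (hp : p.1 ^ 2 + p.2.1 ^ 2 + p.2.2 ^ 2 = 1) :
    (rot3 α p).1 ^ 2 + (rot3 α p).2.1 ^ 2 + (rot3 α p).2.2 ^ 2 = 1 := by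
  simp only [rot3]
  linear_combination (p.1 ^ 2 + p.2.1 ^ 2) * sin_sq_add_cos_sq α + hp

lemma Fs_meas (a b α : ℝ) : Measurable (Fs a b α) := by
  unfold Fs; fun_prop

lemma half_int (c0 c1 c2 : ℝ) (g : ℝ → ℝ) (hg : ∀ θ, g θ = cos (θ / 2) *
    (c0 + c1 * sin (θ/2) ^ 2 + c2 * sin (θ / 2) ^ 4)) :
    ∫ θ in (0:ℝ)..π, g θ = 2 * (c0 + c1 / 3 + c2 / 5) := by
  have key : ∀ θ ∈ uIcc 0 π, HasDerivAt (fun θ => 2 * (c0 * sin (θ/2) + c1 / 3 * sin (θ/2) ^ 3 + c2 / 5 * sin (θ/2) ^ 5)) (g θ) θ := by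
    intro θ _
    have h1 : HasDerivAt (fun θ : ℝ => sin (θ/2)) (cos (θ/2) * (1/2)) θ :=
      ((hasDerivAt_id' θ).div_const 2).sin
    refine ((((h1.const_mul c0).add ((h1.pow 3).const_mul (c1/3))).add
      ((h1.pow 5).const_mul (c2/5))).const_mul 2).congr_deriv ?_
    rw [hg]
    push_cast
    ring
  rw [intervalIntegral.integral_eq_sub_of_hasDerivAt key]
  · simp
  · apply Continuous.intervalIntegrable
    have : g = fun θ => cos (θ / 2) * (c0 + c1 * sin (θ/2) ^ 2 + c2 * sin (θ / 2) ^ 4) := funext hg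
    rw [this]; fun_prop

lemma cosphi_int (k0 k1 k2 : ℝ) :
    ∫ φ in (-π)..π, (k0 + k1 * cos φ + k2 * cos φ ^ 2) = 2 * π * k0 + π * k2 := by
  have key : ∀ φ ∈ uIcc (-π) π, HasDerivAt (fun φ => k0 * φ + k1 * sin φ + k2 * ((φ + sin φ * cos φ) / 2))
      (k0 + k1 * cos φ + k2 * cos φ ^ 2) φ := by
    intro φ _
    refine ((((hasDerivAt_id' φ).const_mul k0).add ((hasDerivAt_sin φ).const_mul k1)).add
      ((((hasDerivAt_id' φ).add ((hasDerivAt_sin φ).mul (hasDerivAt_cos φ))).div_const 2).const_mul k2)).congr_deriv ?_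
    have := sin_sq_add_cos_sq φ
    linear_combination (-k2 / 2) * this
  rw [intervalIntegral.integral_eq_sub_of_hasDerivAt key]
  · simp; ring
  · apply Continuous.intervalIntegrable
    fun_prop

lemma sphere_eval (a b α : ℝ) :
    ∫ φ in (0:ℝ)..(2 * π), ∫ θ in (0:ℝ)..π, sin θ * Fs a b α (emb (φ, θ)) =
      8 * π * (a * (-(1/5) - cos α ^ 2 / 15) + b * (cos α * sin α / 15)) := by
  have hper : Function.Periodic (fun φ => ∫ θ in (0:ℝ)..π, sin θ * Fs a b α (emb (φ, θ))) (2 * π) := by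
    intro φ
    simp only [emb, cos_add_two_pi, sin_add_two_pi]
  have hp := hper.intervalIntegral_add_eq 0 (-π)
  rw [zero_add, show -π + 2 * π = π by ring] at hp
  rw [hp, ← nuS_integral (fun q => Fs a b α (emb q)) ((Fs_meas a b α).comp emb_meas) _
      (fun q => Fs_bound a b α _ (emb_unit q)), nuS_rot_integral α _ (Fs_meas a b α),
      nuS_integral (fun q => Fs a b α (rot3 α (emb q))) ((Fs_meas a b α).comp ((rot3_meas α).comp emb_meas)) _
      (fun q => Fs_bound a b α _ (rot_unit _ _ (emb_unit q)))]
  -- explicit form after the rotation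
  set S := sin α
  set C := cos α
  have hSC : S ^ 2 + C ^ 2 = 1 := sin_sq_add_cos_sq α
  -- num = n0 + n1 cos φ + n2 cos^2 φ
  have hpt : ∀ φ, ∀ θ ∈ Ioo 0 π, sin θ * Fs a b α (rot3 α (emb (φ, θ))) =
      cos (θ/2) * (a * (S * (S * cos θ + C * (sin θ * cos φ)) - 1 + (C * cos θ - S * (sin θ * cos φ)) ^ 2)
        + b * (S * cos θ + C * (sin θ * cos φ)) * (C - (C * cos θ - S * (sin θ * cos φ)))) := by
    intro φ θ hθ
    simp only [Fs, rot3, emb]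
    have hs2 : 0 < sin (θ/2) := sin_pos_of_pos_of_lt_pi (by linarith [hθ.1]) (by linarith [hθ.2, pi_pos])
    have hct : cos θ = 1 - 2 * sin (θ/2) ^ 2 := by
      have := cos_two_mul (θ/2)
      rw [show 2 * (θ/2) = θ by ring] at this
      linear_combination this + 2 * sin_sq_add_cos_sq (θ/2)
    have hst : sin θ = 2 * sin (θ/2) * cos (θ/2) := by
      have := sin_two_mul (θ/2)
      rwa [show 2 * (θ/2) = θ by ring] at this
    have hsq : √(2 - 2 * (sin α * (sin α * cos θ + cos α * (sin θ * cos φ)) +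
        cos α * (cos α * cos θ - sin α * (sin θ * cos φ)))) = 2 * sin (θ/2) := by
      rw [show 2 - 2 * (sin α * (sin α * cos θ + cos α * (sin θ * cos φ)) +
        cos α * (cos α * cos θ - sin α * (sin θ * cos φ))) = (2 * sin (θ/2)) ^ 2 by
          linear_combination (-2 * cos θ) * hSC - 2 * hct]
      exact sqrt_sq (by positivity)
    rw [hsq, mul_div_assoc', div_eq_iff (by positivity)]
    simp only [S, C]
    linear_combination (a * (sin α * (sin α * cos θ + cos α * (sin θ * cos φ)) - 1 + (cos α * cos θ - sin α * (sin θ * cos φ)) ^ 2)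
        + b * (sin α * cos θ + cos α * (sin θ * cos φ)) * (cos α - (cos α * cos θ - sin α * (sin θ * cos φ)))) * hst
  have hct : ∀ θ : ℝ, cos θ = 1 - 2 * sin (θ/2) ^ 2 := by
    intro θ
    have := cos_two_mul (θ/2)
    rw [show 2 * (θ/2) = θ by ring] at this
    linear_combination this + 2 * sin_sq_add_cos_sq (θ/2)
  have hst2 : ∀ θ : ℝ, sin θ ^ 2 = 4 * sin (θ/2) ^ 2 - 4 * sin (θ/2) ^ 4 := by
    intro θ
    have := hct θ
    have h2 := sin_sq_add_cos_sq θ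
    rw [this] at h2
    linear_combination h2
  set K1 := ∫ θ in (0:ℝ)..π, cos (θ/2) * (a * (S * C * sin θ - 2 * C * S * cos θ * sin θ) +
      b * (S ^ 2 * cos θ * sin θ + C ^ 2 * sin θ * (1 - cos θ)))
  have hinner : ∀ φ, ∫ θ in (0:ℝ)..π, sin θ * Fs a b α (rot3 α (emb (φ, θ))) =
      2 * (a * (S^2 - 1 + C^2) + (a * (-2 * S^2 - 4 * C^2) + 2 * b * S * C) / 3 + (4 * a * C^2 - 4 * b * S * C) / 5)
       + K1 * cos φ + (2 * ((4 * (a * S^2 + b * S * C)) / 3 - 4 * (a * S^2 + b * S * C) / 5)) * cos φ ^ 2 := by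
    intro φ
    have e1 : ∫ θ in (0:ℝ)..π, sin θ * Fs a b α (rot3 α (emb (φ, θ))) =
      ∫ θ in (0:ℝ)..π, (cos (θ/2) * (a * (S ^2 * cos θ - 1 + C^2 * cos θ ^2) + b * (S * C * cos θ * (1 - cos θ)))
        + (cos (θ/2) * (a * (S * C * sin θ - 2 * C * S * cos θ * sin θ) +
      b * (S ^ 2 * cos θ * sin θ + C ^ 2 * sin θ * (1 - cos θ)))) * cos φ
        + (cos (θ/2) * ((a * S^2 + b * S * C) * sin θ ^ 2)) * cos φ ^ 2) := by
      rw [intervalIntegral.integral_of_le pi_pos.le, intervalIntegral.integral_of_le pi_pos.le,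
        integral_Ioc_eq_integral_Ioo, integral_Ioc_eq_integral_Ioo]
      apply setIntegral_congr_fun measurableSet_Ioo
      intro θ hθ
      simp only
      rw [hpt φ θ hθ]
      ring
    rw [e1, intervalIntegral.integral_add, intervalIntegral.integral_add,
      intervalIntegral.integral_mul_const, intervalIntegral.integral_mul_const,
      half_int (a * (S^2 - 1 + C^2)) (a * (-2 * S^2 - 4 * C^2) + 2 * b * S * C) (4 * a * C^2 - 4 * b * S * C)
        (fun θ => cos (θ/2) * (a * (S ^2 * cos θ - 1 + C^2 * cos θ ^2) + b * (S * C * cos θ * (1 - cos θ)))),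
      half_int 0 (4 * (a * S^2 + b * S * C)) (-4 * (a * S^2 + b * S * C))
        (fun θ => cos (θ/2) * ((a * S^2 + b * S * C) * sin θ ^ 2))]
    · simp only [K1]; ring
    · intro θ; rw [hst2 θ]; ring
    · intro θ; rw [hct θ]; ring
    all_goals apply Continuous.intervalIntegrable; fun_prop
  simp_rw [hinner]
  rw [cosphi_int]
  have hS : S^2 = 1 - C^2 := by linarith
  rw [hS]
  ring

def Iop (r : ℝ → ℝ) (a b θ : ℝ) : ℝ :=
  ∫ φ in (0:ℝ)..(2 * π), ∫ θb in (0:ℝ)..π,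
      (r θb * sin θb - deriv r θb * cos θb) / betaR r θ θb φ * (r θb * sin θb) *
        (a * (r θ * sin θ * cos φ - r θb * sin θb) + b * cos φ * (r θ * cos θ - r θb * cos θb))

lemma A1_eq (r : ℝ → ℝ) (c θ : ℝ) :
    A1op r c θ = -(1 / (8 * π * r θ)) * Iop r (sin θ) (cos θ) θ + c * sin θ / r θ := by
  unfold A1op Iop
  congr 2
  apply intervalIntegral.integral_congr; intro φ _
  apply intervalIntegral.integral_congr; intro θb _
  simp only
  congr 1
  linear_combination (-(r θ * cos φ)) * sin_sq_add_cos_sq θ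

lemma A2_eq (r : ℝ → ℝ) (c θ : ℝ) :
    A2op r c θ = -(1 / (8 * π)) * Iop r (-cos θ) (sin θ) θ - c * cos θ := by
  unfold A2op Iop
  congr 2
  apply intervalIntegral.integral_congr; intro φ _
  apply intervalIntegral.integral_congr; intro θb _
  simp only
  congr 1
  ring

lemma ae_sin_ne : ∀ᵐ φ : ℝ, sin φ ≠ 0 := by
  have h : {φ : ℝ | ¬ sin φ ≠ 0} = range (fun n : ℤ => (n : ℝ) * π) := by
    ext φ
    simp [sin_eq_zero_iff]
  rw [ae_iff, h]
  exact (countable_range _).measure_zero _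

def Sd (d θ : ℝ) : ℝ := √(1 - d ^ 2 * sin θ ^ 2)
def rb (d θ : ℝ) : ℝ := -d * cos θ + √(1 - d ^ 2 * sin θ ^ 2)
def al (d θ : ℝ) : ℝ := θ - arcsin (d * sin θ)

lemma Sd_arg_pos {d : ℝ} (hd : |d| < 1) (θ : ℝ) : 0 < 1 - d ^ 2 * sin θ ^ 2 := by
  have h1 : d ^ 2 < 1 := by rw [← sq_abs]; nlinarith [abs_nonneg d]
  nlinarith [sin_sq_le_one θ, sq_nonneg d, sq_nonneg (sin θ)]

lemma Sd_pos {d : ℝ} (hd : |d| < 1) (θ : ℝ) : 0 < Sd d θ := sqrt_pos.2 (Sd_arg_pos hd θ)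

lemma Sd_sq {d : ℝ} (hd : |d| < 1) (θ : ℝ) : Sd d θ ^ 2 = 1 - d ^ 2 * sin θ ^ 2 :=
  sq_sqrt (Sd_arg_pos hd θ).le

lemma rb_eq (d θ : ℝ) : rb d θ = -d * cos θ + Sd d θ := rfl

lemma rb_pos {d : ℝ} (hd : |d| < 1) (θ : ℝ) : 0 < rb d θ := by
  have h1 : d ^ 2 < 1 := by rw [← sq_abs]; nlinarith [abs_nonneg d]
  have h : |d * cos θ| < Sd d θ := by
    apply lt_sqrt_of_sq_lt
    rw [sq_abs]
    nlinarith [sin_sq_add_cos_sq θ]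
  rw [rb_eq]
  linarith [(abs_lt.1 h).2]

lemma cos_al {d : ℝ} (hd : |d| < 1) (θ : ℝ) : cos (al d θ) = rb d θ * cos θ + d := by
  have hd' := abs_lt.1 hd
  have hb : |d * sin θ| ≤ 1 := by
    rw [abs_mul]; nlinarith [abs_sin_le_one θ, abs_nonneg d, abs_nonneg (sin θ)]
  rw [al, cos_sub, cos_arcsin, sin_arcsin (abs_le.1 hb).1 (abs_le.1 hb).2, rb, mul_pow]
  linear_combination d * sin_sq_add_cos_sq θ

lemma sin_al {d : ℝ} (hd : |d| < 1) (θ : ℝ) : sin (al d θ) = rb d θ * sin θ := by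
  have hd' := abs_lt.1 hd
  have hb : |d * sin θ| ≤ 1 := by
    rw [abs_mul]; nlinarith [abs_sin_le_one θ, abs_nonneg d, abs_nonneg (sin θ)]
  rw [al, sin_sub, cos_arcsin, sin_arcsin (abs_le.1 hb).1 (abs_le.1 hb).2, rb, mul_pow]
  ring

lemma Sd_hasDeriv {d : ℝ} (hd : |d| < 1) (θ : ℝ) :
    HasDerivAt (Sd d) (-(d ^ 2 * sin θ * cos θ) / Sd d θ) θ := by
  have h := ((((hasDerivAt_sin θ).pow 2).const_mul (d ^ 2)).const_sub 1).sqrt (Sd_arg_pos hd θ).ne'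
  refine h.congr_deriv ?_
  have := (Sd_pos hd θ).ne'
  simp only [Sd, Pi.pow_apply] at *
  field_simp
  push_cast
  simp
  ring

lemma rb_hasDeriv {d : ℝ} (hd : |d| < 1) (θ : ℝ) :
    HasDerivAt (rb d) (d * sin θ - d ^ 2 * sin θ * cos θ / Sd d θ) θ := by
  refine (((hasDerivAt_cos θ).const_mul (-d)).add (Sd_hasDeriv hd θ)).congr_deriv ?_
  ring

lemma al_hasDeriv {d : ℝ} (hd : |d| < 1) (θ : ℝ) :
    HasDerivAt (al d) (1 - d * cos θ / Sd d θ) θ := by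
  have hb : |d * sin θ| < 1 := by
    rw [abs_mul]; nlinarith [abs_sin_le_one θ, abs_nonneg d, abs_nonneg (sin θ)]
  have h := (hasDerivAt_id' θ).sub ((hasDerivAt_arcsin (abs_lt.1 hb).1.ne' (abs_lt.1 hb).2.ne).comp θ ((hasDerivAt_sin θ).const_mul d))
  refine h.congr_deriv ?_
  simp only [Sd, mul_pow]
  ring

lemma Sd_cont {d : ℝ} : Continuous (Sd d) := by unfold Sd; fun_prop

lemma rb_eval {d : ℝ} (hd : |d| < 1) (a b : ℝ) {θ : ℝ} (hθ : θ ∈ Ioo 0 π) :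
    Iop (rb d) a b θ = 8 * π * (a * (-(1/5) - (rb d θ * cos θ + d) ^ 2 / 15) +
      b * ((rb d θ * cos θ + d) * (rb d θ * sin θ) / 15)) := by
  rw [← cos_al hd, ← sin_al hd, ← sphere_eval]
  unfold Iop
  apply intervalIntegral.integral_congr_ae
  filter_upwards [ae_sin_ne] with φ hφ _
  have hsα : 0 < sin (al d θ) := by
    rw [sin_al hd]; exact mul_pos (rb_pos hd θ) (sin_pos_of_mem_Ioo hθ)
  have hpos : ∀ β : ℝ, 0 < 2 - 2 * (sin (al d θ) * (sin β * cos φ) + cos (al d θ) * cos β) := by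
    intro β
    have e : 2 - 2 * (sin (al d θ) * (sin β * cos φ) + cos (al d θ) * cos β) =
      (sin (al d θ) * cos φ - sin β) ^ 2 + (sin (al d θ) * sin φ) ^ 2 + (cos (al d θ) - cos β) ^ 2 := by
      linear_combination (-(sin (al d θ)) ^ 2) * sin_sq_add_cos_sq φ - sin_sq_add_cos_sq β
        - sin_sq_add_cos_sq (al d θ)
    rw [e]
    have : 0 < (sin (al d θ) * sin φ) ^ 2 := by positivity
    positivity
  have hcont : Continuous (fun β => sin β * Fs a b (al d θ) (emb (φ, β))) := by
    simp only [Fs, emb]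
    refine continuous_sin.mul (Continuous.div (by fun_prop) (by fun_prop) ?_)
    intro β
    exact (sqrt_pos.2 (hpos β)).ne'
  have hcv := intervalIntegral.integral_comp_mul_deriv (a := 0) (b := π) (f := al d)
    (f' := fun θ => 1 - d * cos θ / Sd d θ) (g := fun β => sin β * Fs a b (al d θ) (emb (φ, β)))
    (fun x _ => al_hasDeriv hd x)
    (Continuous.continuousOn (continuous_const.sub ((by fun_prop : Continuous fun θ => d * cos θ).div
        Sd_cont (fun x => (Sd_pos hd x).ne')))) hcont
  have h0 : al d 0 = 0 := by simp [al]
  have hπ : al d π = π := by simp [al]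
  rw [h0, hπ] at hcv
  rw [← hcv]
  apply intervalIntegral.integral_congr
  intro θb _
  simp only [Function.comp, Fs, emb]
  have hB : betaR (rb d) θ θb φ = √(2 - 2 * (sin (al d θ) * (sin (al d θb) * cos φ) + cos (al d θ) * cos (al d θb))) := by
    unfold betaR
    congr 1
    have h1 := sin_sq_add_cos_sq (al d θ)
    have h2 := sin_sq_add_cos_sq (al d θb)
    rw [sin_al hd, cos_al hd] at *
    rw [sin_al hd, cos_al hd] at *
    linear_combination (-(rb d θ) ^ 2) * sin_sq_add_cos_sq θ - (rb d θb) ^ 2 * sin_sq_add_cos_sq θb + h1 + h2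
  rw [hB]
  have hB0 : √(2 - 2 * (sin (al d θ) * (sin (al d θb) * cos φ) + cos (al d θ) * cos (al d θb))) ≠ 0 :=
    (sqrt_pos.2 (hpos _)).ne'
  generalize √(2 - 2 * (sin (al d θ) * (sin (al d θb) * cos φ) + cos (al d θ) * cos (al d θb))) = B at *
  have hn : rb d θb * sin θb - deriv (rb d) θb * cos θb = sin (al d θb) * (1 - d * cos θb / Sd d θb) := by
    rw [(rb_hasDeriv hd θb).deriv, sin_al hd, rb_eq]
    have := (Sd_pos hd θb).ne'
    field_simp
    ring
  rw [hn]
  have e1 : rb d θ * cos θ = cos (al d θ) - d := by rw [cos_al hd]; ring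
  have e2 : rb d θb * cos θb = cos (al d θb) - d := by rw [cos_al hd]; ring
  rw [e1, e2, ← sin_al hd, ← sin_al hd]
  generalize (1 - d * cos θb / Sd d θb) = J
  rw [show sin (al d θ) * (sin (al d θb) * cos φ) - 1 + cos (al d θb) ^ 2 =
    sin (al d θb) * (sin (al d θ) * cos φ - sin (al d θb)) by
      linear_combination sin_sq_add_cos_sq (al d θb)]
  field_simp
  ring

def Bf (p q m : ℝ) : ℝ := √(p ^ 2 + q ^ 2 + m ^ 2)
def ff (A C p q m : ℝ) : ℝ := (A * p + C * q) / Bf p q m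
/-- directional derivative of `ff` -/
def dff (A C p q m p' q' m' : ℝ) : ℝ :=
  (A * p' + C * q') / Bf p q m - (A * p + C * q) * (p * p' + q * q' + m * m') / Bf p q m ^ 3

lemma Bf_pos (p q : ℝ) {m : ℝ} (hm : m ≠ 0) : 0 < Bf p q m := by
  unfold Bf; positivity

lemma Bf_sq (p q m : ℝ) : Bf p q m ^ 2 = p ^ 2 + q ^ 2 + m ^ 2 := by
  unfold Bf; rw [sq_sqrt]; positivity

lemma abs_p_le (p q m : ℝ) : |p| ≤ Bf p q m :=
  abs_le_sqrt (by nlinarith [sq_nonneg q, sq_nonneg m])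
lemma abs_q_le (p q m : ℝ) : |q| ≤ Bf p q m :=
  abs_le_sqrt (by nlinarith [sq_nonneg p, sq_nonneg m])
lemma abs_m_le (p q m : ℝ) : |m| ≤ Bf p q m :=
  abs_le_sqrt (by nlinarith [sq_nonneg q, sq_nonneg p])

lemma ff_hasDeriv (A C : ℝ) {p q m : ℝ → ℝ} {p' q' m' x : ℝ} (hp : HasDerivAt p p' x)
    (hq : HasDerivAt q q' x) (hm : HasDerivAt m m' x) (h0 : m x ≠ 0) :
    HasDerivAt (fun y => ff A C (p y) (q y) (m y)) (dff A C (p x) (q x) (m x) p' q' m') x := by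
  have hB := Bf_pos (p x) (q x) h0
  have h1 : HasDerivAt (fun y => Bf (p y) (q y) (m y))
      ((p x * p' + q x * q' + m x * m') / Bf (p x) (q x) (m x)) x := by
    have h2 := (((hp.fun_pow 2).fun_add (hq.fun_pow 2)).fun_add (hm.fun_pow 2)).sqrt
      (by have := sq_pos_of_ne_zero h0; positivity)
    refine h2.congr_deriv ?_
    have hB' := hB.ne'
    unfold Bf at *
    field_simp
    push_cast
    ring
  refine (((hp.const_mul A).fun_add (hq.const_mul C)).fun_div h1 hB.ne').congr_deriv ?_
  unfold dff
  have := hB.ne'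
  field_simp

lemma N_le {A C : ℝ} (hA : |A| ≤ 1) (hC : |C| ≤ 1) (p q m : ℝ) :
    |A * p + C * q| ≤ 2 * Bf p q m := by
  have h1 := abs_p_le p q m
  have h2 := abs_q_le p q m
  calc |A * p + C * q| ≤ |A| * |p| + |C| * |q| := by
        rw [← abs_mul, ← abs_mul]; exact abs_add_le _ _
    _ ≤ 1 * |p| + 1 * |q| := by gcongr
    _ ≤ _ := by linarith

lemma ff_le {A C : ℝ} (hA : |A| ≤ 1) (hC : |C| ≤ 1) (p q m : ℝ) : |ff A C p q m| ≤ 2 := by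
  unfold ff
  have hB0 : 0 ≤ Bf p q m := sqrt_nonneg _
  rw [abs_div, abs_of_nonneg hB0]
  exact div_le_of_le_mul₀ hB0 (by norm_num) (N_le hA hC p q m)

lemma dff_le {A C : ℝ} (hA : |A| ≤ 1) (hC : |C| ≤ 1) (p q : ℝ) {m : ℝ} (hm : m ≠ 0)
    {p' q' m' U : ℝ} (hp : |p'| ≤ U) (hq : |q'| ≤ U) (hm' : |m'| ≤ U) :
    |dff A C p q m p' q' m'| ≤ 8 * U / Bf p q m := by
  have hB := Bf_pos p q hm
  have hU : 0 ≤ U := (abs_nonneg _).trans hp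
  have hN := N_le hA hC p q m
  have h1 : |A * p' + C * q'| ≤ 2 * U := by
    calc |A * p' + C * q'| ≤ |A| * |p'| + |C| * |q'| := by
          rw [← abs_mul, ← abs_mul]; exact abs_add_le _ _
      _ ≤ 1 * U + 1 * U := by gcongr
      _ ≤ _ := by linarith
  have h2 : |p * p' + q * q' + m * m'| ≤ 3 * U * Bf p q m := by
    calc |p * p' + q * q' + m * m'| ≤ |p| * |p'| + |q| * |q'| + |m| * |m'| := by
          rw [← abs_mul, ← abs_mul, ← abs_mul]; exact abs_add_three _ _ _
      _ ≤ Bf p q m * U + Bf p q m * U + Bf p q m * U := by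
          gcongr
          · exact abs_p_le p q m
          · exact abs_q_le p q m
          · exact abs_m_le p q m
      _ = _ := by ring
  unfold dff
  refine (abs_sub _ _).trans ?_
  rw [abs_div, abs_div, abs_mul, abs_of_pos hB, abs_of_pos (pow_pos hB 3)]
  calc _ ≤ 2 * U / Bf p q m + (2 * Bf p q m) * (3 * U * Bf p q m) / Bf p q m ^ 3 := by gcongr
    _ = _ := by field_simp; ring

/-- derivative in rho only -/
lemma dff_rho_le {A C : ℝ} (hA : |A| ≤ 1) (hC : |C| ≤ 1) (p q : ℝ) {m : ℝ} (hm : m ≠ 0) :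
    |dff A C p q m (-1) 0 0| ≤ 8 / Bf p q m := by
  have := dff_le hA hC p q hm (p' := -1) (q' := 0) (m' := 0) (U := 1) (by simp) (by simp) (by simp)
  simpa using this

lemma dff_lin (A C p q m a p1 q1 m1 b p2 q2 m2 : ℝ) :
    dff A C p q m (a * p1 + b * p2) (a * q1 + b * q2) (a * m1 + b * m2) =
      a * dff A C p q m p1 q1 m1 + b * dff A C p q m p2 q2 m2 := by
  unfold dff; ring

/-- Lower bounds on the distance. -/
lemma Bf_ge1 (P0 ρ q φ : ℝ) : |ρ| * |sin φ| ≤ Bf (P0 * cos φ - ρ) q (P0 * sin φ) := by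
  rw [← abs_mul]
  apply abs_le_sqrt
  nlinarith [sq_nonneg q, sq_nonneg (P0 - ρ * cos φ), sin_sq_add_cos_sq φ, 
    show (P0 * cos φ - ρ) ^ 2 + (P0 * sin φ) ^ 2 - (ρ * sin φ) ^ 2 = (P0 - ρ * cos φ) ^ 2 by
      linear_combination (P0 ^ 2 - ρ ^ 2) * sin_sq_add_cos_sq φ]

lemma Bf_expand (rθ rt θ t φ : ℝ) :
    (rθ * sin θ * cos φ - rt * sin t) ^ 2 + (rθ * cos θ - rt * cos t) ^ 2 + (rθ * sin θ * sin φ) ^ 2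
      = rθ ^ 2 + rt ^ 2 - 2 * rθ * rt * (sin θ * sin t * cos φ + cos θ * cos t) := by
  linear_combination rθ ^ 2 * sin_sq_add_cos_sq θ + rt ^ 2 * sin_sq_add_cos_sq t +
    rθ ^ 2 * sin θ ^ 2 * sin_sq_add_cos_sq φ

lemma Bf_ge2 {δ rθ rt θ t φ : ℝ} (hδ : 0 < δ) (h1 : δ ≤ rθ) (h2 : δ ≤ rt) (hθ : θ ∈ Icc 0 π)
    (ht : t ∈ Icc 0 π) :
    2 * δ / π * |θ - t| ≤
      Bf (rθ * sin θ * cos φ - rt * sin t) (rθ * cos θ - rt * cos t) (rθ * sin θ * sin φ) := by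
  have hs1 := sin_nonneg_of_mem_Icc hθ
  have hs2 := sin_nonneg_of_mem_Icc ht
  unfold Bf
  rw [Bf_expand]
  apply le_sqrt_of_sq_le
  have hx : |θ - t| ≤ π := by rw [abs_le]; constructor <;> linarith [hθ.1, hθ.2, ht.1, ht.2]
  have hj := mul_le_sin (x := |θ - t| / 2) (by positivity) (by linarith)
  have hc : cos (θ - t) = 1 - 2 * sin (|θ - t| / 2) ^ 2 := by
    have := cos_two_mul (|θ - t| / 2)
    rw [show 2 * (|θ - t| / 2) = |θ - t| by ring, cos_abs] at this
    rw [this]; linear_combination 2 * sin_sq_add_cos_sq (|θ - t| / 2)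
  have hc2 : sin θ * sin t * cos φ + cos θ * cos t ≤ cos (θ - t) := by
    rw [cos_sub]
    have : sin θ * sin t * cos φ ≤ sin θ * sin t * 1 := by
      gcongr; exact cos_le_one φ
    linarith
  have hrθ : 0 < rθ := by linarith
  have hrt : 0 < rt := by linarith
  have hr : δ * δ ≤ rθ * rt := by gcongr
  have hj2 : 2 / π * (|θ - t| / 2) = |θ - t| / π := by ring
  rw [hj2] at hj
  have h3 : (|θ - t| / π) ^ 2 ≤ sin (|θ - t| / 2) ^ 2 := by gcongr
  have hpp : 0 < rθ * rt := by positivity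
  calc (2 * δ / π * |θ - t|) ^ 2 = 4 * (δ * δ) * (|θ - t| / π) ^ 2 := by ring
    _ ≤ 4 * (rθ * rt) * sin (|θ - t| / 2) ^ 2 := by gcongr
    _ = 2 * (rθ * rt) * (1 - cos (θ - t)) := by rw [hc]; ring
    _ ≤ 2 * (rθ * rt) * (1 - (sin θ * sin t * cos φ + cos θ * cos t)) := by gcongr
    _ ≤ _ := by nlinarith [sq_nonneg (rθ - rt)]

lemma interp {x a c : ℝ} (hx : 0 ≤ x) (h1 : x ≤ a) (h2 : x ≤ c) :
    x ≤ a ^ (2 / 3 : ℝ) * c ^ (1 / 3 : ℝ) := by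
  have ha : 0 ≤ a := hx.trans h1
  calc x = x ^ (2 / 3 : ℝ) * x ^ (1 / 3 : ℝ) := by
        rw [← rpow_add' hx (by norm_num)]; norm_num
    _ ≤ _ := by gcongr

/-- singular kernel in the angle -/
def sk (φ : ℝ) : ℝ := |sin φ| ^ (-(2 / 3) : ℝ)
def kk (x : ℝ) : ℝ := 1 + |x| ^ (-(1 / 3) : ℝ)

lemma sk_ge {φ : ℝ} (h : sin φ ≠ 0) : 1 ≤ sk φ := by
  unfold sk
  exact one_le_rpow_of_pos_of_le_one_of_nonpos (abs_pos.2 h) (abs_sin_le_one φ) (by norm_num)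

lemma kk_ge (x : ℝ) : 1 ≤ kk x := by
  unfold kk; have : 0 ≤ |x| ^ (-(1 / 3) : ℝ) := by positivity
  linarith

lemma rho_div_le {L δ rθ rt θ t φ : ℝ} (hδ : 0 < δ) (h1 : δ ≤ rθ) (h2 : δ ≤ rt) (h3 : rt ≤ L)
    (hθ : θ ∈ Ioo 0 π) (ht : t ∈ Icc 0 π) (hφ : sin φ ≠ 0) (hne : t ≠ θ) :
    rt * sin t / Bf (rθ * sin θ * cos φ - rt * sin t) (rθ * cos θ - rt * cos t) (rθ * sin θ * sin φ)
      ≤ (L * π / (2 * δ)) ^ (1 / 3 : ℝ) * (sk φ * kk (θ - t)) := by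
  have hs := sin_pos_of_mem_Ioo hθ
  have hs2 := sin_nonneg_of_mem_Icc ht
  have hrt : 0 < rt := by linarith
  have hrθ : 0 < rθ := by linarith
  have hm : rθ * sin θ * sin φ ≠ 0 := by positivity
  set B := Bf (rθ * sin θ * cos φ - rt * sin t) (rθ * cos θ - rt * cos t) (rθ * sin θ * sin φ) with hBdef
  have hB : 0 < B := Bf_pos _ _ hm
  have e1 : rt * sin t / B ≤ |sin φ|⁻¹ := by
    rw [div_le_iff₀ hB, inv_mul_eq_div, le_div_iff₀ (by positivity)]
    have := Bf_ge1 (rθ * sin θ) (rt * sin t) (rθ * cos θ - rt * cos t) φ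
    rwa [abs_of_nonneg (by positivity : 0 ≤ rt * sin t)] at this
  have hd : 0 < |θ - t| := abs_pos.2 (sub_ne_zero.2 hne.symm)
  have e2 : rt * sin t / B ≤ (L * π / (2 * δ)) * |θ - t|⁻¹ := by
    have hb := Bf_ge2 (φ := φ) hδ h1 h2 (Ioo_subset_Icc_self hθ) ht
    rw [← hBdef] at hb
    have hL : 0 ≤ L := by linarith
    calc rt * sin t / B ≤ L * 1 / (2 * δ / π * |θ - t|) := by
          gcongr
          exact sin_le_one t
      _ = _ := by field_simp
  have := interp (by positivity) e1 e2
  refine this.trans ?_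
  have hL : 0 ≤ L := by linarith
  rw [mul_rpow (by positivity) (by positivity), inv_rpow (by positivity), inv_rpow (by positivity),
    ← rpow_neg (by positivity), ← rpow_neg (by positivity)]
  unfold sk kk
  have hp : 0 ≤ |sin φ| ^ (-(2 / 3) : ℝ) * (L * π / (2 * δ)) ^ (1 / 3 : ℝ) := by positivity
  nlinarith

def Hh (A C φ θ : ℝ) (g g' : ℝ → ℝ) (t : ℝ) : ℝ :=
  (g t * sin t - g' t * cos t) * (g t * sin t) *
    ff A C (g θ * sin θ * cos φ - g t * sin t) (g θ * cos θ - g t * cos t) (g θ * sin θ * sin φ)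

def rl (S u : ℝ → ℝ) (l t : ℝ) : ℝ := S t + l * u t

def dH (A C φ θ : ℝ) (g g' u u' : ℝ → ℝ) (t : ℝ) : ℝ :=
  (u t * sin t - u' t * cos t) * (g t * sin t) *
    ff A C (g θ * sin θ * cos φ - g t * sin t) (g θ * cos θ - g t * cos t) (g θ * sin θ * sin φ)
  + (g t * sin t - g' t * cos t) * (u t * sin t) *
    ff A C (g θ * sin θ * cos φ - g t * sin t) (g θ * cos θ - g t * cos t) (g θ * sin θ * sin φ)
  + (g t * sin t - g' t * cos t) * (g t * sin t) *
    dff A C (g θ * sin θ * cos φ - g t * sin t) (g θ * cos θ - g t * cos t) (g θ * sin θ * sin φ)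
      (u θ * sin θ * cos φ - u t * sin t) (u θ * cos θ - u t * cos t) (u θ * sin θ * sin φ)

def Gg (A C φ θ : ℝ) (g u : ℝ → ℝ) (t : ℝ) : ℝ :=
  (g t * sin t) * (u t * cos t) *
    ff A C (g θ * sin θ * cos φ - g t * sin t) (g θ * cos θ - g t * cos t) (g θ * sin θ * sin φ)

def dG (A C φ θ : ℝ) (g g' u u' : ℝ → ℝ) (t : ℝ) : ℝ :=
  ((g' t * sin t + g t * cos t) * (u t * cos t) + (g t * sin t) * (u' t * cos t - u t * sin t)) *
    ff A C (g θ * sin θ * cos φ - g t * sin t) (g θ * cos θ - g t * cos t) (g θ * sin θ * sin φ)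
  + (g t * sin t) * (u t * cos t) *
    dff A C (g θ * sin θ * cos φ - g t * sin t) (g θ * cos θ - g t * cos t) (g θ * sin θ * sin φ)
      (-(g' t * sin t + g t * cos t)) (-(g' t * cos t - g t * sin t)) 0

def Rm (A C φ θ : ℝ) (g g' u : ℝ → ℝ) (t : ℝ) : ℝ :=
  g t * u t * (
    ff A C (g θ * sin θ * cos φ - g t * sin t) (g θ * cos θ - g t * cos t) (g θ * sin θ * sin φ)
    + g t * sin t *
    dff A C (g θ * sin θ * cos φ - g t * sin t) (g θ * cos θ - g t * cos t) (g θ * sin θ * sin φ) (-1) 0 0)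
  + (g t * sin t - g' t * cos t) * (g t * sin t) *
    dff A C (g θ * sin θ * cos φ - g t * sin t) (g θ * cos θ - g t * cos t) (g θ * sin θ * sin φ)
      (u θ * sin θ * cos φ) (u θ * cos θ) (u θ * sin θ * sin φ)

lemma dH_eq (A C φ θ : ℝ) (g g' u u' : ℝ → ℝ) (t : ℝ) :
    dH A C φ θ g g' u u' t = - dG A C φ θ g g' u u' t + Rm A C φ θ g g' u t := by
  unfold dH dG Rm
  generalize (g θ * sin θ * cos φ - g t * sin t) = p
  generalize (g θ * cos θ - g t * cos t) = q
  generalize (g θ * sin θ * sin φ) = m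
  generalize ff A C p q m = f
  unfold dff
  generalize Bf p q m = B
  linear_combination (g t * u t * f + g t * sin t * g t * u t *
    ((A * (-1) + C * 0) / B - (A * p + C * q) * (p * (-1) + q * 0 + m * 0) / B ^ 3)) * sin_sq_add_cos_sq t

lemma Hh_hasDeriv (A C φ θ : ℝ) (S S' u u' : ℝ → ℝ) (t l : ℝ)
    (h0 : rl S u l θ * sin θ * sin φ ≠ 0) :
    HasDerivAt (fun l => Hh A C φ θ (rl S u l) (rl S' u' l) t)
      (dH A C φ θ (rl S u l) (rl S' u' l) u u' t) l := by
  have hr : ∀ x, HasDerivAt (fun l => rl S u l x) (u x) l := by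
    intro x
    simpa [rl] using ((hasDerivAt_id' l).mul_const (u x)).const_add (S x)
  have hr' : ∀ x, HasDerivAt (fun l => rl S' u' l x) (u' x) l := by
    intro x
    simpa [rl] using ((hasDerivAt_id' l).mul_const (u' x)).const_add (S' x)
  have hf := ff_hasDeriv A C
    (((hr θ).mul_const (sin θ)).mul_const (cos φ) |>.fun_sub ((hr t).mul_const (sin t)))
    (((hr θ).mul_const (cos θ)).fun_sub ((hr t).mul_const (cos t)))
    (((hr θ).mul_const (sin θ)).mul_const (sin φ)) h0
  refine (((((hr t).mul_const (sin t)).fun_sub ((hr' t).mul_const (cos t))).fun_mul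
    ((hr t).mul_const (sin t))).fun_mul hf).congr_deriv ?_
  unfold dH
  ring

lemma Gg_hasDeriv (A C φ θ : ℝ) (g u : ℝ → ℝ) (g' u' : ℝ → ℝ) (t : ℝ)
    (h0 : g θ * sin θ * sin φ ≠ 0) (hg : HasDerivAt g (g' t) t) (hu : HasDerivAt u (u' t) t) :
    HasDerivAt (Gg A C φ θ g u) (dG A C φ θ g g' u u' t) t := by
  have hs := hasDerivAt_sin t
  have hc := hasDerivAt_cos t
  have hf := ff_hasDeriv A C ((hg.fun_mul hs).const_sub (g θ * sin θ * cos φ))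
    ((hg.fun_mul hc).const_sub (g θ * cos θ)) (hasDerivAt_const t (g θ * sin θ * sin φ)) h0
  refine (((hg.fun_mul hs).fun_mul (hu.fun_mul hc)).fun_mul hf).congr_deriv ?_
  unfold dG
  rw [show g' t * cos t + g t * -sin t = g' t * cos t - g t * sin t by ring]
  ring

lemma Gg_int (A C φ θ : ℝ) (g u g' u' : ℝ → ℝ) (hg' : ∀ᵐ t : ℝ, HasDerivAt g (g' t) t)
    (hu' : ∀ᵐ t : ℝ, HasDerivAt u (u' t) t) {Kg Ku : NNReal} (hg : LipschitzWith Kg g)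
    (hu : LipschitzWith Ku u) (h0 : g θ * sin θ * sin φ ≠ 0) :
    IntervalIntegrable (dG A C φ θ g g' u u') volume 0 π ∧
      ∫ t in (0:ℝ)..π, dG A C φ θ g g' u u' t = 0 := by
  set m := g θ * sin θ * sin φ with hm
  have hac : AbsolutelyContinuousOnInterval (Gg A C φ θ g u) 0 π := by
    set Φ : ℝ × ℝ × ℝ → ℝ := fun x => (x.2.1 * sin x.1) * (x.2.2 * cos x.1) *
      ff A C (g θ * sin θ * cos φ - x.2.1 * sin x.1) (g θ * cos θ - x.2.1 * cos x.1) m with hΦ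
    have hΦd : ContDiff ℝ 1 Φ := by
      simp only [hΦ, ff, Bf]
      have hsn : ContDiff ℝ 1 (fun x : ℝ × ℝ × ℝ => sin x.1) := contDiff_sin.comp contDiff_fst
      have hcs : ContDiff ℝ 1 (fun x : ℝ × ℝ × ℝ => cos x.1) := contDiff_cos.comp contDiff_fst
      refine ContDiff.mul (by fun_prop) (ContDiff.div (by fun_prop) (ContDiff.sqrt (by fun_prop) ?_) ?_)
      · intro x; positivity
      · intro x; positivity
    have hl : LocallyLipschitz Φ := hΦd.locallyLipschitz
    have hcomp : LipschitzWith (max 1 (max Kg Ku)) (fun t : ℝ => (t, g t, u t)) :=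
      LipschitzWith.id.prodMk (hg.prodMk hu)
    have hl2 : LocallyLipschitz (Φ ∘ fun t : ℝ => (t, g t, u t)) := hl.comp hcomp.locallyLipschitz
    have hl3 := (hl2.locallyLipschitzOn (s := uIcc 0 π)).exists_lipschitzOnWith_of_compact isCompact_uIcc
    obtain ⟨K, hK⟩ := hl3
    exact hK.absolutelyContinuousOnInterval
  have hae : ∀ᵐ t : ℝ, deriv (Gg A C φ θ g u) t = dG A C φ θ g g' u u' t := by
    filter_upwards [hg', hu'] with t h1 h2
    exact (Gg_hasDeriv A C φ θ g u g' u' t h0 h1 h2).deriv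
  constructor
  · exact hac.intervalIntegrable_deriv.congr_ae (ae_restrict_of_ae hae)
  · rw [← intervalIntegral.integral_congr_ae (hae.mono fun t h _ => h), hac.integral_deriv_eq_sub]
    simp [Gg]

lemma absrpow_int0 {p : ℝ} (hp : -1 < p) {b : ℝ} (hb : 0 ≤ b) :
    IntervalIntegrable (fun x : ℝ => |x| ^ p) volume 0 b := by
  refine (intervalIntegral.intervalIntegrable_rpow' hp).congr ?_
  intro x hx
  rw [uIoc_of_le hb] at hx
  simp only [abs_of_pos hx.1]

lemma absrpow_int {p : ℝ} (hp : -1 < p) (a b : ℝ) :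
    IntervalIntegrable (fun x : ℝ => |x| ^ p) volume a b := by
  have key : ∀ b : ℝ, IntervalIntegrable (fun x : ℝ => |x| ^ p) volume 0 b := by
    intro b
    rcases le_total 0 b with hb | hb
    · exact absrpow_int0 hp hb
    · have := (absrpow_int0 hp (neg_nonneg.2 hb))
      rw [IntervalIntegrable.iff_comp_neg] at this
      simpa using this
  exact (key a).symm.trans (key b)

lemma kk_int (a b : ℝ) : IntervalIntegrable kk volume a b := by
  unfold kk
  exact intervalIntegrable_const.add (absrpow_int (by norm_num) a b)

lemma kk_sq_int (a b : ℝ) : IntervalIntegrable (fun x => kk x ^ 2) volume a b := by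
  have h : (fun x => kk x ^ 2) = fun x => (1 + 2 * |x| ^ (-(1/3) : ℝ)) + |x| ^ (-(2/3) : ℝ) := by
    funext x
    unfold kk
    have : |x| ^ (-(2/3) : ℝ) = (|x| ^ (-(1/3) : ℝ)) ^ 2 := by
      rw [← rpow_natCast, ← rpow_mul (abs_nonneg x)]; norm_num
    rw [this]; ring
  rw [h]
  exact (intervalIntegrable_const.add ((absrpow_int (by norm_num) a b).const_mul 2)).add
    (absrpow_int (by norm_num) a b)

lemma kk_shift_int (θ : ℝ) : IntervalIntegrable (fun t => kk (θ - t)) volume 0 π := by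
  have := (kk_int (θ - 0) (θ - π)).comp_sub_left θ
  simpa using this

lemma kk_sq_shift_int (θ : ℝ) : IntervalIntegrable (fun t => kk (θ - t) ^ 2) volume 0 π := by
  have := (kk_sq_int (θ - 0) (θ - π)).comp_sub_left θ
  simpa using this

def CK : ℝ := ∫ x in (-π)..π, kk x ^ 2

lemma kk_sq_le {θ : ℝ} (hθ : θ ∈ Icc 0 π) : ∫ t in (0:ℝ)..π, kk (θ - t) ^ 2 ≤ CK := by
  rw [intervalIntegral.integral_comp_sub_left (fun x => kk x ^ 2) θ]
  have h := pi_pos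
  apply intervalIntegral.integral_mono_interval (by linarith [hθ.1]) (by linarith) (by linarith [hθ.2])
  · exact Eventually.of_forall fun x => sq_nonneg _
  · exact kk_sq_int _ _

lemma sk_int : IntervalIntegrable sk volume 0 (2 * π) := by
  have hper : Function.Periodic sk π := by
    intro x; simp [sk, sin_add_pi]
  refine hper.intervalIntegrable pi_pos.ne' (t := -(π/2)) ?_ _ _
  have h1 := ((absrpow_int (p := -(2/3)) (by norm_num) (-(π/2)) (-(π/2) + π)).const_mul
    ((2 / π) ^ (-(2/3) : ℝ)))
  refine h1.mono_fun' ((measurable_sin.abs.pow_const _).aestronglyMeasurable) ?_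
  rw [uIoc_of_le (by linarith [pi_pos])]
  rw [EventuallyLE, ae_restrict_iff' measurableSet_Ioc]
  have hne : ∀ᵐ x : ℝ, x ≠ 0 := by
    rw [ae_iff]; simp
  filter_upwards [hne] with x hx0 hx
  unfold sk
  rw [norm_of_nonneg (by positivity), ← mul_rpow (by positivity) (by positivity)]
  have hxa : 0 < |x| := abs_pos.2 hx0
  have hle : |x| ≤ π / 2 := by rw [abs_le]; constructor <;> linarith [hx.1, hx.2]
  have h2 : 2 / π * |x| ≤ |sin x| := by
    have := mul_le_sin hxa.le hle
    rcases abs_cases x with ⟨h, _⟩ | ⟨h, _⟩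
    · rw [h] at this ⊢; exact this.trans (le_abs_self _)
    · rw [h] at this ⊢; rw [sin_neg] at this; exact this.trans (neg_le_abs _)
  exact rpow_le_rpow_of_nonpos (by positivity) h2 (by norm_num)

/-- Pointwise bounds. -/
lemma Rm_le {A C φ θ L δ : ℝ} {g g' u : ℝ → ℝ} {t : ℝ} (hA : |A| ≤ 1) (hC : |C| ≤ 1)
    (hδ : 0 < δ) (h1 : δ ≤ g θ) (h2 : δ ≤ g t) (h3 : g t ≤ L) (h4 : |g' t| ≤ L)
    (hθ : θ ∈ Ioo 0 π) (ht : t ∈ Icc 0 π) (hφ : sin φ ≠ 0) (hne : t ≠ θ) :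
    |Rm A C φ θ g g' u t| ≤ (L * (2 + 24 * (L * π / (2 * δ)) ^ (1 / 3 : ℝ))) * sk φ *
      (kk (θ - t) * (|u t| + |u θ|)) := by
  have hs := sin_pos_of_mem_Ioo hθ
  have hs2 := sin_nonneg_of_mem_Icc ht
  have hgt : 0 < g t := by linarith
  have hgθ : 0 < g θ := by linarith
  have hL : 0 < L := by linarith
  have hm : g θ * sin θ * sin φ ≠ 0 := by positivity
  have hr := rho_div_le hδ h1 h2 h3 hθ ht hφ hne
  have hff := ff_le hA hC (g θ * sin θ * cos φ - g t * sin t) (g θ * cos θ - g t * cos t) (g θ * sin θ * sin φ)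
  have hd1 := dff_rho_le hA hC (g θ * sin θ * cos φ - g t * sin t) (g θ * cos θ - g t * cos t) hm
  have hd2 := dff_le hA hC (g θ * sin θ * cos φ - g t * sin t) (g θ * cos θ - g t * cos t) hm
    (p' := u θ * sin θ * cos φ) (q' := u θ * cos θ) (m' := u θ * sin θ * sin φ) (U := |u θ|)
    (by rw [abs_mul, abs_mul]
        calc |u θ| * |sin θ| * |cos φ| ≤ |u θ| * 1 * 1 := by
              gcongr
              · exact abs_sin_le_one θ
              · exact abs_cos_le_one φ
          _ = _ := by ring)
    (by rw [abs_mul]; exact mul_le_of_le_one_right (abs_nonneg _) (abs_cos_le_one θ))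
    (by rw [abs_mul, abs_mul]
        calc |u θ| * |sin θ| * |sin φ| ≤ |u θ| * 1 * 1 := by
              gcongr
              · exact abs_sin_le_one θ
              · exact abs_sin_le_one φ
          _ = _ := by ring)
  unfold Rm
  set B := Bf (g θ * sin θ * cos φ - g t * sin t) (g θ * cos θ - g t * cos t) (g θ * sin θ * sin φ)
  set κ := (L * π / (2 * δ)) ^ (1 / 3 : ℝ) with hκ
  have hκ0 : 0 ≤ κ := by positivity
  have hk : 1 ≤ sk φ * kk (θ - t) := by nlinarith [sk_ge hφ, kk_ge (θ - t)]
  set k := sk φ * kk (θ - t)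
  have hrho : |g t * sin t| = g t * sin t := abs_of_nonneg (by positivity)
  have hN : |g t * sin t - g' t * cos t| ≤ 2 * L := by
    calc |g t * sin t - g' t * cos t| ≤ |g t * sin t| + |g' t * cos t| := abs_sub _ _
      _ ≤ L * 1 + L * 1 := by
          rw [hrho, abs_mul]; gcongr
          · exact sin_le_one t
          · exact abs_cos_le_one t
      _ = _ := by ring
  refine (abs_add_le _ _).trans ?_
  rw [abs_mul, abs_mul, abs_mul (_ * _) (dff _ _ _ _ _ _ _ _), abs_mul (_ - _), hrho, abs_of_pos hgt]
  have t1 : |g t * sin t * dff A C (g θ * sin θ * cos φ - g t * sin t) (g θ * cos θ - g t * cos t) (g θ * sin θ * sin φ) (-1) 0 0| ≤ 8 * (κ * k) := by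
    rw [abs_mul, hrho]
    calc _ ≤ g t * sin t * (8 / B) := by gcongr
      _ = 8 * (g t * sin t / B) := by ring
      _ ≤ _ := by gcongr
  calc _ ≤ L * |u t| * (2 + 8 * (κ * k)) + 2 * L * (g t * sin t) * (8 * |u θ| / B) := by
        gcongr
        exact (abs_add_le _ _).trans (add_le_add hff t1)
    _ = L * |u t| * (2 + 8 * (κ * k)) + 16 * L * |u θ| * (g t * sin t / B) := by ring
    _ ≤ L * |u t| * (2 * k + 8 * (κ * k)) + 16 * L * |u θ| * (κ * k) := by gcongr; linarith
    _ ≤ (L * (2 + 24 * κ)) * k * (|u t| + |u θ|) := by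
        have : 0 ≤ k := by linarith
        have e1 : 0 ≤ L * |u t| * (κ * k) := by positivity
        have e2 : 0 ≤ L * |u θ| * (κ * k) := by positivity
        have e3 : 0 ≤ L * |u θ| * k := by positivity
        nlinarith
    _ = _ := by simp only [k]; ring

lemma abs3 {x y z X Y Z : ℝ} (hx : |x| ≤ X) (hy : |y| ≤ Y) (hz : |z| ≤ Z) :
    |x * y * z| ≤ X * Y * Z := by
  have := (abs_nonneg _).trans hx
  have := (abs_nonneg _).trans hy
  rw [abs_mul, abs_mul]; gcongr

lemma dH_le {A C φ θ L b0 : ℝ} {g g' u u' : ℝ → ℝ} {t : ℝ} (hA : |A| ≤ 1) (hC : |C| ≤ 1)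
    (hb0 : 0 < b0) (hm : b0 ≤ |g θ * sin θ * sin φ|)
    (h3 : |g t| ≤ L) (h4 : |g' t| ≤ L) (h5 : |u t| ≤ L) (h6 : |u' t| ≤ L) (h7 : |u θ| ≤ L) :
    |dH A C φ θ g g' u u' t| ≤ 8 * L ^ 2 + 32 * L ^ 3 / b0 := by
  have hL : 0 ≤ L := (abs_nonneg _).trans h3
  have hm0 : g θ * sin θ * sin φ ≠ 0 := abs_pos.1 (hb0.trans_le hm)
  have hff := ff_le hA hC (g θ * sin θ * cos φ - g t * sin t) (g θ * cos θ - g t * cos t) (g θ * sin θ * sin φ)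
  have s1 : ∀ {x y : ℝ}, |x| ≤ L → |y| ≤ 1 → |x * y| ≤ L := by
    intro x y hx hy
    rw [abs_mul]
    calc |x| * |y| ≤ L * 1 := by gcongr
      _ = L := mul_one L
  have s2 : ∀ {x y : ℝ}, |x| ≤ L → |y| ≤ L → |x - y| ≤ 2 * L := by
    intro x y hx hy
    exact (abs_sub _ _).trans (by linarith)
  have a1 := abs_sin_le_one t
  have a2 := abs_cos_le_one t
  have hd2 := dff_le hA hC (g θ * sin θ * cos φ - g t * sin t) (g θ * cos θ - g t * cos t) hm0
    (p' := u θ * sin θ * cos φ - u t * sin t) (q' := u θ * cos θ - u t * cos t)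
    (m' := u θ * sin θ * sin φ) (U := 2 * L)
    (s2 (s1 (s1 h7 (abs_sin_le_one θ)) (abs_cos_le_one φ)) (s1 h5 a1))
    (s2 (s1 h7 (abs_cos_le_one θ)) (s1 h5 a2))
    ((s1 (s1 h7 (abs_sin_le_one θ)) (abs_sin_le_one φ)).trans (by linarith))
  have hB : b0 ≤ Bf (g θ * sin θ * cos φ - g t * sin t) (g θ * cos θ - g t * cos t) (g θ * sin θ * sin φ) :=
    hm.trans (abs_m_le _ _ _)
  have hd3 := hd2.trans (div_le_div_of_nonneg_left (by positivity) hb0 hB)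
  unfold dH
  refine (abs_add_three _ _ _).trans ?_
  have e1 := s2 (s1 h5 a1) (s1 h6 a2)
  have e2 := s2 (s1 h3 a1) (s1 h4 a2)
  calc _ ≤ (2 * L) * L * 2 + (2 * L) * L * 2 + (2 * L) * L * (8 * (2 * L) / b0) :=
        add_le_add (add_le_add (abs3 e1 (s1 h3 a1) hff) (abs3 e2 (s1 h5 a1) hff))
          (abs3 e2 (s1 h3 a1) hd3)
    _ = _ := by ring

def C0 (L δ : ℝ) : ℝ := (2 * L) * (2 + 24 * ((2 * L) * π / (2 * δ)) ^ (1 / 3 : ℝ))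

lemma J_bound {A C φ θ L δ : ℝ} {S u S' u' : ℝ → ℝ} {KS Ku : NNReal} (hS : LipschitzWith KS S)
    (hu : LipschitzWith Ku u) (hS' : ∀ᵐ t : ℝ, HasDerivAt S (S' t) t)
    (hu' : ∀ᵐ t : ℝ, HasDerivAt u (u' t) t) (hS'm : Measurable S') (hu'm : Measurable u')
    (b1 : ∀ t ∈ Icc 0 π, |S t| ≤ L) (b2 : ∀ t ∈ Icc 0 π, |u t| ≤ L) (b3 : ∀ t, |S' t| ≤ L)
    (b4 : ∀ t, |u' t| ≤ L) (hδ : 0 < δ) (p1 : ∀ t ∈ Icc 0 π, δ ≤ S t)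
    (p2 : ∀ t ∈ Icc 0 π, δ ≤ S t + u t) (hA : |A| ≤ 1) (hC : |C| ≤ 1) (hφ : sin φ ≠ 0)
    (hθ : θ ∈ Ioo 0 π) :
    |(∫ t in (0:ℝ)..π, Hh A C φ θ (rl S u 1) (rl S' u' 1) t) -
      ∫ t in (0:ℝ)..π, Hh A C φ θ (rl S u 0) (rl S' u' 0) t| ≤
      C0 L δ * sk φ * ∫ t in (0:ℝ)..π, kk (θ - t) * (|u t| + |u θ|) := by
  have hθ' := Ioo_subset_Icc_self hθ
  have hsθ := sin_pos_of_mem_Ioo hθ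
  have hL : 0 < L := hδ.trans_le ((p1 θ hθ').trans ((le_abs_self _).trans (b1 θ hθ')))
  set ε := min 1 (δ / (2 * L)) with hε
  have hε0 : 0 < ε := by positivity
  have hε1 : ε ≤ 1 := min_le_left _ _
  have hεL : ε * L ≤ δ / 2 := by
    calc ε * L ≤ δ / (2 * L) * L := by gcongr; exact min_le_right _ _
      _ = _ := by field_simp
  have low : ∀ l ∈ Ioo (-ε) (1 + ε), ∀ t ∈ Icc 0 π, δ / 2 ≤ rl S u l t := by
    intro l hl t ht
    have h1 := p1 t ht
    have h2 := p2 t ht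
    have h3 := abs_le.1 (b2 t ht)
    unfold rl
    rcases lt_or_ge l 0 with h | h
    · nlinarith [hl.1]
    · rcases le_or_gt l 1 with h' | h'
      · nlinarith
      · nlinarith [hl.2]
  have absl : ∀ l ∈ Ioo (-ε) (1 + ε), |l| ≤ 2 := by
    intro l hl; rw [abs_le]; constructor <;> linarith [hl.1, hl.2]
  have rlb : ∀ l ∈ Ioo (-ε) (1 + ε), ∀ {x y : ℝ}, |x| ≤ L → |y| ≤ L → |x + l * y| ≤ 3 * L := by
    intro l hl x y hx hy
    calc |x + l * y| ≤ |x| + |l| * |y| := by rw [← abs_mul]; exact abs_add_le _ _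
      _ ≤ L + 2 * L := by gcongr; exact absl l hl
      _ = _ := by ring
  have hScont := hS.continuous.measurable
  have hucont := hu.continuous.measurable
  have mH : ∀ l, Measurable (Hh A C φ θ (rl S u l) (rl S' u' l)) := by
    intro l
    unfold Hh rl ff Bf
    fun_prop
  have mdH : ∀ l, Measurable (dH A C φ θ (rl S u l) (rl S' u' l) u u') := by
    intro l
    unfold dH rl ff dff Bf
    fun_prop
  have hder : ∀ l ∈ Ioo (-ε) (1 + ε),
      IntervalIntegrable (dH A C φ θ (rl S u l) (rl S' u' l) u u') volume 0 π ∧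
      HasDerivAt (fun l => ∫ t in (0:ℝ)..π, Hh A C φ θ (rl S u l) (rl S' u' l) t)
        (∫ t in (0:ℝ)..π, dH A C φ θ (rl S u l) (rl S' u' l) u u' t) l := by
    intro l hl
    have hb0 : ∀ l ∈ Ioo (-ε) (1 + ε), δ / 2 * sin θ * |sin φ| ≤ |rl S u l θ * sin θ * sin φ| := by
      intro l hl
      have := low l hl θ hθ'
      rw [abs_mul, abs_mul, abs_of_pos hsθ]
      gcongr
      exact this.trans (le_abs_self _)
    have hb0p : 0 < δ / 2 * sin θ * |sin φ| := by positivity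
    apply intervalIntegral.hasDerivAt_integral_of_dominated_loc_of_deriv_le
      (bound := fun _ => 8 * (3 * L) ^ 2 + 32 * (3 * L) ^ 3 / (δ / 2 * sin θ * |sin φ|))
      (isOpen_Ioo.mem_nhds hl)
    · exact Eventually.of_forall fun l => (mH l).aestronglyMeasurable
    · refine (intervalIntegrable_const (c := (6 * L) * (3 * L) * 2)).mono_fun' (mH l).aestronglyMeasurable ?_
      rw [uIoc_of_le pi_pos.le, EventuallyLE, ae_restrict_iff' measurableSet_Ioc]
      refine Eventually.of_forall fun t ht => ?_
      have ht' : t ∈ Icc 0 π := Ioc_subset_Icc_self ht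
      have e1 := rlb l hl (b1 t ht') (b2 t ht')
      have e2 := rlb l hl (b3 t) (b4 t)
      unfold Hh
      rw [norm_eq_abs]
      have s1 : ∀ {x y : ℝ}, |x| ≤ 3 * L → |y| ≤ 1 → |x * y| ≤ 3 * L := by
        intro x y hx hy
        rw [abs_mul]
        calc |x| * |y| ≤ 3 * L * 1 := by gcongr
          _ = 3 * L := mul_one _
      refine abs3 ?_ (s1 e1 (abs_sin_le_one t)) (ff_le hA hC _ _ _)
      exact (abs_sub _ _).trans ((add_le_add (s1 e1 (abs_sin_le_one t)) (s1 e2 (abs_cos_le_one t))).trans (by linarith))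
    · exact (mdH l).aestronglyMeasurable
    · refine Eventually.of_forall fun t ht l hl => ?_
      rw [uIoc_of_le pi_pos.le] at ht
      have ht' : t ∈ Icc 0 π := Ioc_subset_Icc_self ht
      refine dH_le hA hC hb0p (hb0 l hl) (rlb l hl (b1 t ht') (b2 t ht')) (rlb l hl (b3 t) (b4 t))
        ((b2 t ht').trans (by linarith)) ((b4 t).trans (by linarith)) ((b2 θ hθ').trans (by linarith))
    · exact intervalIntegrable_const
    · refine Eventually.of_forall fun t _ l hl => ?_
      exact Hh_hasDeriv A C φ θ S S' u u' t l (abs_pos.1 (hb0p.trans_le (hb0 l hl)))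
  have hsub : Icc (0:ℝ) 1 ⊆ Ioo (-ε) (1 + ε) := fun x hx => ⟨by linarith [hx.1], by linarith [hx.2]⟩
  have hmv := norm_image_sub_le_of_norm_deriv_le_segment_01'
    (f := fun l => ∫ t in (0:ℝ)..π, Hh A C φ θ (rl S u l) (rl S' u' l) t)
    (f' := fun l => ∫ t in (0:ℝ)..π, dH A C φ θ (rl S u l) (rl S' u' l) u u' t)
    (C := C0 L δ * sk φ * ∫ t in (0:ℝ)..π, kk (θ - t) * (|u t| + |u θ|))
    (fun l hl => (hder l (hsub hl)).2.hasDerivWithinAt) ?_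
  · rwa [norm_eq_abs] at hmv
  intro l hl'
  have hl : l ∈ Icc (0:ℝ) 1 := Ico_subset_Icc_self hl'
  have hlU := hsub hl
  have low1 : ∀ t ∈ Icc 0 π, δ ≤ rl S u l t := by
    intro t ht
    have h1 := p1 t ht
    have h2 := p2 t ht
    unfold rl
    nlinarith [hl.1, hl.2]
  have up1 : ∀ {x y : ℝ}, |x| ≤ L → |y| ≤ L → |x + l * y| ≤ 2 * L := by
    intro x y hx hy
    calc |x + l * y| ≤ |x| + |l| * |y| := by rw [← abs_mul]; exact abs_add_le _ _
      _ ≤ L + 1 * L := by gcongr; rw [abs_le]; constructor <;> linarith [hl.1, hl.2]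
      _ = _ := by ring
  have hm0 : rl S u l θ * sin θ * sin φ ≠ 0 := by
    have := low1 θ hθ'
    have : 0 < rl S u l θ := by linarith
    positivity
  have hrlL : LipschitzWith (KS + Real.nnabs l * Ku) (rl S u l) := by
    have h1 : LipschitzWith (Real.nnabs l * Ku) (fun t => l * u t) := by
      apply LipschitzWith.of_dist_le_mul
      intro x y
      have := hu.dist_le_mul x y
      rw [dist_eq_norm, dist_eq_norm] at *
      rw [← mul_sub, norm_mul]
      push_cast
      rw [mul_assoc]
      gcongr
      simp
    exact hS.add h1
  obtain ⟨g1, g2⟩ := Gg_int A C φ θ (rl S u l) u (rl S' u' l) u'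
    (by filter_upwards [hS', hu'] with t h1 h2
        exact h1.fun_add (h2.const_mul l)) hu' hrlL hu hm0
  have hdHint := (hder l hlU).1
  have hRm : IntervalIntegrable (Rm A C φ θ (rl S u l) (rl S' u' l) u) volume 0 π := by
    refine (hdHint.add g1).congr ?_
    intro t _
    simp only [dH_eq]; ring
  have e : ∫ t in (0:ℝ)..π, dH A C φ θ (rl S u l) (rl S' u' l) u u' t =
      ∫ t in (0:ℝ)..π, Rm A C φ θ (rl S u l) (rl S' u' l) u t := by
    have e2 := intervalIntegral.integral_sub hRm g1
    rw [g2, sub_zero] at e2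
    rw [← e2]
    apply intervalIntegral.integral_congr
    intro t _
    simp only [dH_eq]; ring
  rw [e, ← intervalIntegral.integral_const_mul]
  have hki : IntervalIntegrable (fun t => C0 L δ * sk φ * (kk (θ - t) * (|u t| + |u θ|))) volume 0 π :=
    ((kk_shift_int θ).mul_continuousOn (by have := hu.continuous; fun_prop)).const_mul _
  refine intervalIntegral.norm_integral_le_of_norm_le pi_pos.le ?_ hki
  have hne : ∀ᵐ x : ℝ, x ≠ θ := by
    rw [ae_iff]; simp
  filter_upwards [hne] with t htne ht
  have ht' : t ∈ Icc 0 π := Ioc_subset_Icc_self ht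
  rw [norm_eq_abs]
  exact Rm_le hA hC hδ (low1 θ hθ') (low1 t ht') ((le_abs_self _).trans (up1 (b1 t ht') (b2 t ht')))
    (up1 (b3 t) (b4 t)) hθ ht' hφ htne

lemma Iop_Hh (r : ℝ → ℝ) (a b θ : ℝ) :
    Iop r a b θ = ∫ φ in (0:ℝ)..(2 * π), ∫ t in (0:ℝ)..π, Hh a (b * cos φ) φ θ r (deriv r) t := by
  unfold Iop
  apply intervalIntegral.integral_congr; intro φ _
  apply intervalIntegral.integral_congr; intro t _
  simp only [Hh, ff, Bf]
  rw [Bf_expand]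
  unfold betaR
  ring

lemma Hh_le {A C φ θ L : ℝ} {g g' : ℝ → ℝ} {t : ℝ} (hA : |A| ≤ 1) (hC : |C| ≤ 1)
    (e1 : |g t| ≤ L) (e2 : |g' t| ≤ L) : |Hh A C φ θ g g' t| ≤ 2 * L * L * 2 := by
  have hL : 0 ≤ L := (abs_nonneg _).trans e1
  have s1 : ∀ {x y : ℝ}, |x| ≤ L → |y| ≤ 1 → |x * y| ≤ L := by
    intro x y hx hy
    rw [abs_mul]
    calc |x| * |y| ≤ L * 1 := by gcongr
      _ = L := mul_one _
  unfold Hh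
  refine abs3 ?_ (s1 e1 (abs_sin_le_one t)) (ff_le hA hC _ _ _)
  exact (abs_sub _ _).trans ((add_le_add (s1 e1 (abs_sin_le_one t)) (s1 e2 (abs_cos_le_one t))).trans (by linarith))

lemma Hh_phi_int {a b θ L : ℝ} {g g' : ℝ → ℝ} (ha : |a| ≤ 1) (hb : |b| ≤ 1) (hg : Measurable g)
    (hg' : Measurable g') (e1 : ∀ t ∈ Icc 0 π, |g t| ≤ L) (e2 : ∀ t, |g' t| ≤ L) :
    IntervalIntegrable (fun φ => ∫ t in (0:ℝ)..π, Hh a (b * cos φ) φ θ g g' t) volume 0 (2 * π) := by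
  have hm : Measurable (fun x : ℝ × ℝ => Hh a (b * cos x.1) x.1 θ g g' x.2) := by
    unfold Hh ff Bf
    fun_prop
  have hm2 : StronglyMeasurable (fun φ => ∫ t in (0:ℝ)..π, Hh a (b * cos φ) φ θ g g' t) := by
    simp only [intervalIntegral.integral_of_le pi_pos.le]
    exact hm.stronglyMeasurable.integral_prod_right
  refine (intervalIntegrable_const (c := 2 * L * L * 2 * |π - 0|)).mono_fun' hm2.aestronglyMeasurable ?_
  refine Eventually.of_forall fun φ => ?_
  apply intervalIntegral.norm_integral_le_of_norm_le_const
  intro t ht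
  rw [uIoc_of_le pi_pos.le] at ht
  refine Hh_le ha ?_ (e1 t (Ioc_subset_Icc_self ht)) (e2 t)
  rw [abs_mul]
  exact mul_le_one₀ hb (abs_nonneg _) (abs_cos_le_one φ)

def Cst (L δ : ℝ) : ℝ := C0 L δ * ∫ φ in (0:ℝ)..(2 * π), sk φ

lemma Iop_stab {a b θ L δ : ℝ} {R S : ℝ → ℝ} {KR KS : NNReal} (hR : LipschitzWith KR R)
    (hS : LipschitzWith KS S)
    (b1 : ∀ t ∈ Icc 0 π, |S t| ≤ L) (b1' : ∀ t ∈ Icc 0 π, |R t| ≤ L)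
    (b2 : ∀ t ∈ Icc 0 π, |R t - S t| ≤ L) (b3 : ∀ t, |deriv S t| ≤ L)
    (b3' : ∀ t, |deriv R t| ≤ L)
    (b4 : ∀ t, |deriv R t - deriv S t| ≤ L) (hδ : 0 < δ) (p1 : ∀ t ∈ Icc 0 π, δ ≤ S t)
    (p2 : ∀ t ∈ Icc 0 π, δ ≤ R t) (ha : |a| ≤ 1) (hb : |b| ≤ 1) (hθ : θ ∈ Ioo 0 π) :
    |Iop R a b θ - Iop S a b θ| ≤
      Cst L δ * ∫ t in (0:ℝ)..π, kk (θ - t) * (|R t - S t| + |R θ - S θ|) := by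
  rw [Iop_Hh, Iop_Hh, ← intervalIntegral.integral_sub
    (Hh_phi_int ha hb hR.continuous.measurable (measurable_deriv R) b1' b3')
    (Hh_phi_int ha hb hS.continuous.measurable (measurable_deriv S) b1 b3), Cst,
    ← intervalIntegral.integral_const_mul (C0 L δ) sk, ← intervalIntegral.integral_mul_const, ← norm_eq_abs]
  refine intervalIntegral.norm_integral_le_of_norm_le (by positivity) ?_
    ((sk_int.const_mul _).mul_const _)
  filter_upwards [ae_sin_ne] with φ hφ _
  have hJ := J_bound (A := a) (C := b * cos φ) (φ := φ) (θ := θ) (L := L) (δ := δ) (S := S)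
    (u := fun t => R t - S t) (S' := deriv S) (u' := fun t => deriv R t - deriv S t) hS
    (hR.sub hS) (hS.ae_differentiableAt_real.mono fun t h => h.hasDerivAt)
    (by filter_upwards [hS.ae_differentiableAt_real, hR.ae_differentiableAt_real] with t h1 h2
        exact h2.hasDerivAt.fun_sub h1.hasDerivAt)
    (measurable_deriv S) ((measurable_deriv R).sub (measurable_deriv S)) b1 b2 b3 b4 hδ p1
    (fun t ht => by simpa using p2 t ht) ha
    (by rw [abs_mul]; exact mul_le_one₀ hb (abs_nonneg _) (abs_cos_le_one φ)) hφ hθ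
  have r1 : rl S (fun t => R t - S t) 1 = R := by funext t; simp [rl]
  have r2 : rl (deriv S) (fun t => deriv R t - deriv S t) 1 = deriv R := by funext t; simp [rl]
  have r3 : rl S (fun t => R t - S t) 0 = S := by funext t; simp [rl]
  have r4 : rl (deriv S) (fun t => deriv R t - deriv S t) 0 = deriv S := by funext t; simp [rl]
  rw [r1, r2, r3, r4] at hJ
  exact hJ

lemma CK_nonneg : 0 ≤ CK :=
  intervalIntegral.integral_nonneg (by linarith [pi_pos]) fun _ _ => sq_nonneg _

lemma kk_young {w : ℝ → ℝ} (hw : Continuous w) {θ : ℝ} (hθ : θ ∈ Icc 0 π) :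
    |w θ| * ∫ t in (0:ℝ)..π, kk (θ - t) * (|w t| + |w θ|) ≤
      2 * CK * w θ ^ 2 + ∫ t in (0:ℝ)..π, w t ^ 2 := by
  have i1 : IntervalIntegrable (fun t => kk (θ - t) * (|w t| + |w θ|)) volume 0 π :=
    (kk_shift_int θ).mul_continuousOn (by fun_prop)
  have i2 : IntervalIntegrable (fun t => w t ^ 2) volume 0 π := (hw.pow 2).intervalIntegrable _ _
  have i3 := (kk_sq_shift_int θ).const_mul (2 * w θ ^ 2)
  calc |w θ| * ∫ t in (0:ℝ)..π, kk (θ - t) * (|w t| + |w θ|)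
      = ∫ t in (0:ℝ)..π, |w θ| * (kk (θ - t) * (|w t| + |w θ|)) := by
        rw [intervalIntegral.integral_const_mul]
    _ ≤ ∫ t in (0:ℝ)..π, (2 * w θ ^ 2 * kk (θ - t) ^ 2 + w t ^ 2) := by
        apply intervalIntegral.integral_mono_on pi_pos.le (i1.const_mul _) (i3.add i2)
        intro t _
        have h1 := kk_ge (θ - t)
        have h2 := sq_abs (w θ)
        have h3 := sq_abs (w t)
        rw [← h2, ← h3]
        have : 0 ≤ |w θ| := abs_nonneg _
        have : 0 ≤ |w t| := abs_nonneg _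
        nlinarith [sq_nonneg (|w θ| * kk (θ - t) - |w t|), mul_nonneg (sq_nonneg (|w θ|)) (by nlinarith : 0 ≤ kk (θ - t) ^ 2 - kk (θ - t)), mul_nonneg (sq_nonneg (|w θ|)) (sq_nonneg (kk (θ - t)))]
    _ = 2 * w θ ^ 2 * (∫ t in (0:ℝ)..π, kk (θ - t) ^ 2) + ∫ t in (0:ℝ)..π, w t ^ 2 := by
        rw [intervalIntegral.integral_add i3 i2, intervalIntegral.integral_const_mul]
    _ ≤ 2 * w θ ^ 2 * CK + ∫ t in (0:ℝ)..π, w t ^ 2 := by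
        gcongr; exact kk_sq_le hθ
    _ = _ := by ring

def Dd (d θ : ℝ) : ℝ := d * sin θ - d ^ 2 * sin θ * cos θ / Sd d θ
def Xd (d θ : ℝ) : ℝ := rb d θ * cos θ + d
def a1 (d cd θ : ℝ) : ℝ := sin θ * (1 / 5 + Xd d θ * d / 15 + cd) / rb d θ

lemma Xd_le {d : ℝ} (hd : |d| < 1) (θ : ℝ) : |Xd d θ| ≤ 1 := by
  unfold Xd; rw [← cos_al hd]; exact abs_cos_le_one _

lemma Xd_eq {d : ℝ} (θ : ℝ) : Xd d θ = Sd d θ * cos θ + d * sin θ ^ 2 := by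
  unfold Xd; rw [rb_eq]; linear_combination (-d) * sin_sq_add_cos_sq θ

lemma Dd_eq {d : ℝ} (hd : |d| < 1) (θ : ℝ) : Dd d θ = d * sin θ * rb d θ / Sd d θ := by
  have := (Sd_pos hd θ).ne'
  unfold Dd; rw [rb_eq]; field_simp; ring

lemma A2_rb {d : ℝ} (hd : |d| < 1) (cd : ℝ) {θ : ℝ} (hθ : θ ∈ Ioo 0 π) :
    A2op (rb d) cd θ = -cos θ / 5 - Xd d θ * Sd d θ / 15 - cd * cos θ := by
  rw [A2_eq, rb_eval hd _ _ hθ]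
  have hp := pi_pos.ne'
  change _ = -cos θ / 5 - (rb d θ * cos θ + d) * Sd d θ / 15 - cd * cos θ
  rw [show Sd d θ = rb d θ + d * cos θ by rw [rb_eq]; ring]
  field_simp
  linear_combination ((rb d θ * cos θ + d) * (-5 * (rb d θ))) * sin_sq_add_cos_sq θ

lemma A1_rb {d : ℝ} (hd : |d| < 1) (cd : ℝ) {θ : ℝ} (hθ : θ ∈ Ioo 0 π) :
    A1op (rb d) cd θ = a1 d cd θ := by
  rw [A1_eq, rb_eval hd _ _ hθ]
  have hp := pi_pos.ne'
  have hr := (rb_pos hd θ).ne'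
  unfold a1 Xd
  field_simp
  ring

lemma rb_evol {d : ℝ} (hd : |d| < 1) (cd : ℝ) {θ : ℝ} (hθ : θ ∈ Ioo 0 π) :
    A2op (rb d) cd θ - A1op (rb d) cd θ * deriv (rb d) θ =
      (cd + 4 / 15) * (-cos θ - d * sin θ ^ 2 / Sd d θ) := by
  rw [A2_rb hd cd hθ, A1_rb hd cd hθ, (rb_hasDeriv hd θ).deriv]
  have e := Dd_eq hd θ
  unfold Dd at e
  rw [e, a1, Xd_eq]
  have hr := (rb_pos hd θ).ne'
  have hs := (Sd_pos hd θ).ne'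
  have hsq := Sd_sq hd θ
  field_simp
  linear_combination (-5 * (Sd d θ * cos θ + d * sin θ ^ 2)) * hsq

lemma rb_dt {d : ℝ → ℝ} {d' t : ℝ} (hd : |d t| < 1) (h : HasDerivAt d d' t) (θ : ℝ) :
    HasDerivAt (fun τ => rb (d τ) θ) (d' * (-cos θ - d t * sin θ ^ 2 / Sd (d t) θ)) t := by
  have h1 := ((h.fun_pow 2).mul_const (sin θ ^ 2)).const_sub 1
  have h2 := h1.sqrt (Sd_arg_pos hd θ).ne'
  refine ((h.fun_neg.mul_const (cos θ)).fun_add h2).congr_deriv ?_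
  have := (Sd_pos hd θ).ne'
  unfold Sd at *
  push_cast
  field_simp
  ring

/-- uniform bounds with `η ≤ 1 - d²`. -/
lemma Sd_ge {d η : ℝ} (hη : 0 < η) (hd : η ≤ 1 - d ^ 2) (θ : ℝ) : η ≤ Sd d θ := by
  have h1 : η ≤ 1 := by nlinarith [sq_nonneg d]
  apply le_sqrt_of_sq_le
  nlinarith [sin_sq_le_one θ, mul_nonneg (sq_nonneg d) (sub_nonneg.2 (sin_sq_le_one θ))]

lemma Sd_le (d θ : ℝ) : Sd d θ ≤ 1 := by
  exact sqrt_le_one.2 (by nlinarith [sq_nonneg (d * sin θ)])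

lemma abs_lt_one_of {d η : ℝ} (hη : 0 < η) (hd : η ≤ 1 - d ^ 2) : |d| < 1 := by
  rw [← sq_lt_one_iff_abs_lt_one]; linarith

lemma rb_ge {d η : ℝ} (hη : 0 < η) (hd : η ≤ 1 - d ^ 2) (θ : ℝ) : η / 2 ≤ rb d θ := by
  have hd1 := abs_lt_one_of hη hd
  have h0 := rb_pos hd1 θ
  have hS := Sd_sq hd1 θ
  have hc : |d * cos θ| ≤ 1 := by
    rw [abs_mul]; exact mul_le_one₀ hd1.le (abs_nonneg _) (abs_cos_le_one θ)
  have h1 := abs_le.1 hc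
  have e : rb d θ * (Sd d θ + d * cos θ) = 1 - d ^ 2 := by
    rw [rb_eq]; linear_combination hS - d ^ 2 * sin_sq_add_cos_sq θ
  nlinarith [Sd_le d θ]

lemma rb_le {d : ℝ} (hd : |d| < 1) (θ : ℝ) : rb d θ ≤ 2 := by
  have hc : |d * cos θ| ≤ 1 := by
    rw [abs_mul]; exact mul_le_one₀ hd.le (abs_nonneg _) (abs_cos_le_one θ)
  have h1 := abs_le.1 hc
  rw [rb_eq]; linarith [Sd_le d θ]

lemma Dd_le {d η : ℝ} (hη : 0 < η) (hd : η ≤ 1 - d ^ 2) (θ : ℝ) : |Dd d θ| ≤ 2 / η := by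
  have hd1 := abs_lt_one_of hη hd
  rw [Dd_eq hd1, abs_div, abs_mul, abs_mul, abs_of_pos (Sd_pos hd1 θ), abs_of_pos (rb_pos hd1 θ)]
  have := rb_pos hd1 θ
  calc |d| * |sin θ| * rb d θ / Sd d θ ≤ 1 * 1 * 2 / η := by
        gcongr
        · exact abs_sin_le_one θ
        · exact rb_le hd1 θ
        · exact Sd_ge hη hd θ
    _ = _ := by ring

def a1' (d cd θ : ℝ) : ℝ :=
  ((cos θ * (1 / 5 + Xd d θ * d / 15 + cd) + sin θ * ((Dd d θ * cos θ - rb d θ * sin θ) * d / 15)) * rb d θ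
    - sin θ * (1 / 5 + Xd d θ * d / 15 + cd) * Dd d θ) / rb d θ ^ 2

lemma a1_hasDeriv {d : ℝ} (hd : |d| < 1) (cd θ : ℝ) : HasDerivAt (a1 d cd) (a1' d cd θ) θ := by
  have hr : HasDerivAt (rb d) (Dd d θ) θ := rb_hasDeriv hd θ
  have hX : HasDerivAt (Xd d) (Dd d θ * cos θ - rb d θ * sin θ) θ := by
    refine ((hr.fun_mul (hasDerivAt_cos θ)).add_const d).congr_deriv ?_
    ring
  exact ((hasDerivAt_sin θ).fun_mul ((((hX.mul_const d).div_const 15).const_add (1/5)).add_const cd)).fun_div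
    hr (rb_pos hd θ).ne'

lemma a1'_le {d η cd M : ℝ} (hη : 0 < η) (hd : η ≤ 1 - d ^ 2) (hM : |cd| ≤ M) (θ : ℝ) :
    |a1' d cd θ| ≤ (((1 + M) + (2 / η + 2)) * 2 + (1 + M) * (2 / η)) / (η / 2) ^ 2 := by
  have hd1 := abs_lt_one_of hη hd
  have hr := rb_pos hd1 θ
  have hM0 : 0 ≤ M := (abs_nonneg _).trans hM
  have hs := abs_sin_le_one θ
  have hc := abs_cos_le_one θ
  have hD := Dd_le hη hd θ
  have hr2 : |rb d θ| ≤ 2 := by rw [abs_of_pos hr]; exact rb_le hd1 θ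
  have hY : |1 / 5 + Xd d θ * d / 15 + cd| ≤ 1 + M := by
    have h1 : |Xd d θ * d| ≤ 1 := by
      rw [abs_mul]; exact mul_le_one₀ (Xd_le hd1 θ) (abs_nonneg _) hd1.le
    have h2 := abs_le.1 h1
    have h3 := abs_le.1 hM
    rw [abs_le]; constructor <;> linarith
  have hZ : |(Dd d θ * cos θ - rb d θ * sin θ) * d / 15| ≤ 2 / η + 2 := by
    have h1 : |Dd d θ * cos θ - rb d θ * sin θ| ≤ 2 / η + 2 := by
      refine (abs_sub _ _).trans ?_
      rw [abs_mul, abs_mul]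
      calc _ ≤ 2 / η * 1 + 2 * 1 := by gcongr
        _ = _ := by ring
    rw [abs_div, abs_mul]
    have h15 : |(15:ℝ)| = 15 := abs_of_pos (by norm_num)
    rw [h15, div_le_iff₀ (by norm_num)]
    have h0 : 0 ≤ 2 / η + 2 := by positivity
    calc _ ≤ (2 / η + 2) * 1 := by gcongr
      _ ≤ _ := by nlinarith
  unfold a1'
  rw [abs_div, abs_of_pos (pow_pos hr 2)]
  have hnum : |(cos θ * (1 / 5 + Xd d θ * d / 15 + cd) + sin θ * ((Dd d θ * cos θ - rb d θ * sin θ) * d / 15)) * rb d θ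
    - sin θ * (1 / 5 + Xd d θ * d / 15 + cd) * Dd d θ| ≤ ((1 + M) + (2 / η + 2)) * 2 + (1 + M) * (2 / η) := by
    refine (abs_sub _ _).trans ?_
    rw [abs_mul, abs_mul, abs_mul (sin θ)]
    have h1 : |cos θ * (1 / 5 + Xd d θ * d / 15 + cd) + sin θ * ((Dd d θ * cos θ - rb d θ * sin θ) * d / 15)| ≤ (1 + M) + (2 / η + 2) := by
      refine (abs_add_le _ _).trans ?_
      rw [abs_mul, abs_mul]
      calc _ ≤ 1 * (1 + M) + 1 * (2 / η + 2) := by gcongr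
        _ = _ := by ring
    calc _ ≤ ((1 + M) + (2 / η + 2)) * 2 + 1 * (1 + M) * (2 / η) := by gcongr
      _ = _ := by ring
  gcongr
  exact rb_ge hη hd θ

lemma Iop_rb_le {d : ℝ} (hd : |d| < 1) {a b θ : ℝ} (ha : |a| ≤ 1) (hb : |b| ≤ 1) (hθ : θ ∈ Ioo 0 π) :
    |Iop (rb d) a b θ| ≤ 8 * π := by
  rw [rb_eval hd _ _ hθ, ← cos_al hd, ← sin_al hd, abs_mul, abs_of_pos (by positivity)]
  have hc := abs_cos_le_one (al d θ)
  have hs := abs_sin_le_one (al d θ)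
  have h1 : |a * (-(1/5) - cos (al d θ) ^ 2 / 15)| ≤ 1 * (4 / 15) := by
    rw [abs_mul]
    gcongr
    have := cos_sq_le_one (al d θ)
    rw [abs_le]; constructor <;> nlinarith [sq_nonneg (cos (al d θ))]
  have h2 : |b * (cos (al d θ) * sin (al d θ) / 15)| ≤ 1 * (1 / 15) := by
    rw [abs_mul]
    gcongr
    rw [abs_div, abs_mul, abs_of_pos (by norm_num : (0:ℝ) < 15)]
    gcongr
    exact mul_le_one₀ hc (abs_nonneg _) hs
  have := abs_add_le (a * (-(1/5) - cos (al d θ) ^ 2 / 15)) (b * (cos (al d θ) * sin (al d θ) / 15))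
  have hp := pi_pos
  nlinarith

lemma Cst_nonneg {L δ : ℝ} (hL : 0 ≤ L) (hδ : 0 < δ) : 0 ≤ Cst L δ := by
  unfold Cst C0
  have h : 0 ≤ ∫ φ in (0:ℝ)..(2 * π), sk φ :=
    intervalIntegral.integral_nonneg (by positivity) fun φ _ => by unfold sk; positivity
  positivity

def Ca (M η : ℝ) : ℝ := (((1 + M) + (2 / η + 2)) * 2 + (1 + M) * (2 / η)) / (η / 2) ^ 2
def Pc (L δ : ℝ) : ℝ := (1 + L / δ) * Cst L δ / (4 * π)
def Nc (L δ M η : ℝ) : ℝ := 2 * L * (M + 1) / δ ^ 2 + Ca M η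
def Cfin (L δ M η : ℝ) : ℝ := Pc L δ * (2 * CK + π) + Nc L δ M η

lemma pt_bound {w a2R a2S a1R a1S R' S' IR IS JR JS Rr Ss L δ M cd sn C Q ap apc : ℝ}
    (hC : 0 ≤ C) (hδ : 0 < δ) (hR : δ ≤ Rr) (hS : δ ≤ Ss) (hL : 0 ≤ L) (hw : w = Rr - Ss)
    (hM : |cd| ≤ M) (hsn : |sn| ≤ 1)
    (e1 : a1R = -(1 / (8 * π * Rr)) * IR + cd * sn / Rr)
    (e2 : a1S = -(1 / (8 * π * Ss)) * IS + cd * sn / Ss)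
    (e3 : a2R - a2S = -(1 / (8 * π)) * (JR - JS))
    (hI : |w| * |IR - IS| ≤ C * Q) (hJ : |w| * |JR - JS| ≤ C * Q) (hIS : |IS| ≤ 8 * π)
    (hR' : |R'| ≤ L) (hap : |ap| ≤ apc) :
    2 * w * (a2R - a1R * R' - (a2S - a1S * S')) + (ap * w ^ 2 + 2 * a1S * w * (R' - S')) ≤
      (1 + L / δ) * C / (4 * π) * Q + (2 * L * (M + 1) / δ ^ 2 + apc) * w ^ 2 := by
  have hp := pi_pos
  have hRp : 0 < Rr := hδ.trans_le hR
  have hSp : 0 < Ss := hδ.trans_le hS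
  have hM0 : 0 ≤ M := (abs_nonneg _).trans hM
  have k0 : 2 * w * (a2R - a1R * R' - (a2S - a1S * S')) + (ap * w ^ 2 + 2 * a1S * w * (R' - S'))
      = 2 * w * (a2R - a2S) - 2 * (w * (a1R - a1S)) * R' + ap * w ^ 2 := by ring
  have d1 : a1R - a1S = -(1 / (8 * π * Rr)) * (IR - IS)
      + (-w / (Rr * Ss)) * (cd * sn - IS / (8 * π)) := by
    rw [e1, e2, hw]; field_simp; ring
  have b1 : |w * (a1R - a1S)| ≤ C * Q / (8 * π * δ) + (M + 1) / δ ^ 2 * w ^ 2 := by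
    rw [d1, mul_add]
    refine (abs_add_le _ _).trans (add_le_add ?_ ?_)
    · rw [show w * (-(1 / (8 * π * Rr)) * (IR - IS)) = -((w * (IR - IS)) / (8 * π * Rr)) by ring,
        abs_neg, abs_div, abs_mul, abs_of_pos (a := 8 * π * Rr) (by positivity)]
      have : 0 ≤ C * Q := le_trans (by positivity) hI
      gcongr
    · rw [show w * (-w / (Rr * Ss) * (cd * sn - IS / (8 * π)))
        = -(w ^ 2 * (cd * sn - IS / (8 * π)) / (Rr * Ss)) by ring, abs_neg, abs_div, abs_mul,
        abs_of_pos (a := Rr * Ss) (by positivity), abs_of_nonneg (sq_nonneg w)]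
      have h1 : |cd * sn - IS / (8 * π)| ≤ M + 1 := by
        refine (abs_sub _ _).trans (add_le_add ?_ ?_)
        · rw [abs_mul]
          calc |cd| * |sn| ≤ M * 1 := by gcongr
            _ = M := mul_one _
        · rw [abs_div, abs_of_pos (a := 8 * π) (by positivity), div_le_one (by positivity)]
          exact hIS
      calc w ^ 2 * |cd * sn - IS / (8 * π)| / (Rr * Ss) ≤ w ^ 2 * (M + 1) / (δ * δ) := by gcongr
        _ = _ := by ring
  have b2 : 2 * w * (a2R - a2S) ≤ C * Q / (4 * π) := by
    rw [e3, show 2 * w * (-(1 / (8 * π)) * (JR - JS)) = (-(w * (JR - JS))) / (4 * π) by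
      field_simp; ring]
    gcongr
    refine le_trans (neg_le_abs _) ?_
    rwa [abs_mul]
  have b3 : -(2 * (w * (a1R - a1S)) * R') ≤ 2 * (C * Q / (8 * π * δ) + (M + 1) / δ ^ 2 * w ^ 2) * L := by
    refine le_trans (neg_le_abs _) ?_
    rw [abs_mul, abs_mul, abs_two]
    have := (abs_nonneg _).trans b1
    gcongr
  have b4 : ap * w ^ 2 ≤ apc * w ^ 2 := by
    gcongr; exact (le_abs_self _).trans hap
  rw [k0]
  have : (1 + L / δ) * C / (4 * π) * Q + (2 * L * (M + 1) / δ ^ 2 + apc) * w ^ 2 =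
    C * Q / (4 * π) + 2 * (C * Q / (8 * π * δ) + (M + 1) / δ ^ 2 * w ^ 2) * L + apc * w ^ 2 := by
    field_simp; ring
  linarith

lemma rb_lip {d η : ℝ} (hη : 0 < η) (hd : η ≤ 1 - d ^ 2) :
    LipschitzWith (Real.toNNReal (2 / η)) (rb d) := by
  have hd1 := abs_lt_one_of hη hd
  refine lipschitzWith_of_nnnorm_deriv_le (fun t => (rb_hasDeriv hd1 t).differentiableAt) fun t => ?_
  rw [(rb_hasDeriv hd1 t).deriv, ← NNReal.coe_le_coe, coe_nnnorm, Real.coe_toNNReal _ (by positivity)]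
  exact Dd_le hη hd t

lemma energy_ineq {R : ℝ → ℝ} {K : NNReal} {d η cd M δ L : ℝ} (hR : LipschitzWith K R) (hη : 0 < η)
    (hd : η ≤ 1 - d ^ 2) (hM : |cd| ≤ M) (hδ : 0 < δ) (hδη : δ ≤ η / 2)
    (hpos : ∀ t ∈ Icc 0 π, δ ≤ R t) (hL1 : 2 / η + K ≤ L) (hL2 : ∀ t ∈ Icc 0 π, |R t| + 2 ≤ L)
    (hG : IntervalIntegrable (fun θ => 2 * (R θ - rb d θ) * (A2op R cd θ - A1op R cd θ * deriv R θ -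
      (cd + 4 / 15) * (-cos θ - d * sin θ ^ 2 / Sd d θ))) volume 0 π) :
    ∫ θ in (0:ℝ)..π, 2 * (R θ - rb d θ) * (A2op R cd θ - A1op R cd θ * deriv R θ -
      (cd + 4 / 15) * (-cos θ - d * sin θ ^ 2 / Sd d θ)) ≤
      Cfin L δ M η * ∫ θ in (0:ℝ)..π, (R θ - rb d θ) ^ 2 := by
  have hp := pi_pos
  have hd1 := abs_lt_one_of hη hd
  have hS := rb_lip hη hd
  have hL0 : 0 ≤ L := le_trans (by positivity) hL1
  have hK0 : (0:ℝ) ≤ K := K.2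
  have hη2 : 0 ≤ 2 / η := by positivity
  have hRd : ∀ t, |deriv R t| ≤ K := fun t => norm_deriv_le_of_lipschitz hR
  have hSd : ∀ t, |deriv (rb d) t| ≤ 2 / η := fun t => by
    rw [(rb_hasDeriv hd1 t).deriv]; exact Dd_le hη hd t
  have hSab : ∀ t, |rb d t| ≤ 2 := fun t => by
    rw [abs_of_pos (rb_pos hd1 t)]; exact rb_le hd1 t
  set w : ℝ → ℝ := fun θ => R θ - rb d θ with hw
  have hwc : Continuous w := hR.continuous.sub hS.continuous
  set E := ∫ θ in (0:ℝ)..π, w θ ^ 2 with hE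
  have stab : ∀ a b θ, |a| ≤ 1 → |b| ≤ 1 → θ ∈ Ioo 0 π →
      |w θ| * |Iop R a b θ - Iop (rb d) a b θ| ≤ Cst L δ * (2 * CK * w θ ^ 2 + E) := by
    intro a b θ ha hb hθ
    have h1 := Iop_stab (a := a) (b := b) (θ := θ) (L := L) (δ := δ) hR hS
      (fun t ht => by linarith [hSab t, hL2 t ht, abs_nonneg (R t)])
      (fun t ht => by linarith [hL2 t ht])
      (fun t ht => (abs_sub _ _).trans (by linarith [hSab t, hL2 t ht]))
      (fun t => by linarith [hSd t]) (fun t => by linarith [hRd t])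
      (fun t => (abs_sub _ _).trans (by linarith [hSd t, hRd t])) hδ
      (fun t _ => hδη.trans (rb_ge hη hd t)) hpos ha hb hθ
    calc _ ≤ |w θ| * (Cst L δ * ∫ t in (0:ℝ)..π, kk (θ - t) * (|w t| + |w θ|)) := by gcongr
      _ = Cst L δ * (|w θ| * ∫ t in (0:ℝ)..π, kk (θ - t) * (|w t| + |w θ|)) := by ring
      _ ≤ _ := mul_le_mul_of_nonneg_left (kk_young hwc (Ioo_subset_Icc_self hθ)) (Cst_nonneg hL0 hδ)
  -- the transported quantity
  have hac : AbsolutelyContinuousOnInterval (fun θ => a1 d cd θ * (w θ * w θ)) 0 π := by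
    have h1 : AbsolutelyContinuousOnInterval w 0 π :=
      ((hR.sub hS).lipschitzOnWith (s := uIcc 0 π)).absolutelyContinuousOnInterval
    have h2 : AbsolutelyContinuousOnInterval (a1 d cd) 0 π := by
      have : LipschitzWith (Real.toNNReal (Ca M η)) (a1 d cd) := by
        refine lipschitzWith_of_nnnorm_deriv_le (fun t => (a1_hasDeriv hd1 cd t).differentiableAt)
          fun t => ?_
        have h : |a1' d cd t| ≤ Ca M η := a1'_le hη hd hM t
        rw [(a1_hasDeriv hd1 cd t).deriv, ← NNReal.coe_le_coe, coe_nnnorm,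
          Real.coe_toNNReal _ ((abs_nonneg _).trans h)]
        exact h
      exact (this.lipschitzOnWith (s := uIcc 0 π)).absolutelyContinuousOnInterval
    exact h2.mul (h1.mul h1)
  have hint := hac.integral_deriv_eq_sub
  have hii := hac.intervalIntegrable_deriv
  have e0 : ∫ θ in (0:ℝ)..π, deriv (fun θ => a1 d cd θ * (w θ * w θ)) θ = 0 := by
    rw [hint]; simp [a1]
  have hdv : ∀ᵐ θ : ℝ, deriv (fun θ => a1 d cd θ * (w θ * w θ)) θ =
      a1' d cd θ * w θ ^ 2 + 2 * a1 d cd θ * w θ * (deriv R θ - deriv (rb d) θ) := by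
    filter_upwards [hR.ae_differentiableAt_real] with θ h
    have hwd : HasDerivAt w (deriv R θ - deriv (rb d) θ) θ :=
      h.hasDerivAt.fun_sub (rb_hasDeriv hd1 θ).differentiableAt.hasDerivAt
    rw [((a1_hasDeriv hd1 cd θ).fun_mul (hwd.fun_mul hwd)).deriv]
    ring
  have iw : IntervalIntegrable (fun θ => w θ ^ 2) volume 0 π := (hwc.pow 2).intervalIntegrable _ _
  have icst : IntervalIntegrable (fun θ => Pc L δ * (2 * CK * w θ ^ 2 + E) + Nc L δ M η * w θ ^ 2) volume 0 π :=
    Continuous.intervalIntegrable (by fun_prop) _ _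
  have key := intervalIntegral.integral_mono_ae_restrict hp.le (hG.add hii) icst (by
    have : ∀ᵐ θ ∂(volume.restrict (Icc 0 π)), θ ∈ Ioo 0 π := by
      rw [← restrict_Ioo_eq_restrict_Icc]
      exact ae_restrict_mem measurableSet_Ioo
    filter_upwards [this, ae_restrict_of_ae hdv] with θ hθ hdθ
    beta_reduce
    rw [hdθ, ← rb_evol hd1 cd hθ]
    have h := pt_bound (w := w θ) (a2R := A2op R cd θ) (a2S := A2op (rb d) cd θ)
      (a1R := A1op R cd θ) (a1S := A1op (rb d) cd θ) (R' := deriv R θ) (S' := deriv (rb d) θ)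
      (Q := 2 * CK * w θ ^ 2 + E) (ap := a1' d cd θ) (apc := Ca M η)
      (Cst_nonneg hL0 hδ) hδ (hpos θ (Ioo_subset_Icc_self hθ)) (hδη.trans (rb_ge hη hd θ)) hL0 rfl hM
      (abs_sin_le_one θ) (A1_eq R cd θ) (A1_eq (rb d) cd θ) (by rw [A2_eq, A2_eq]; ring)
      (stab _ _ θ (abs_sin_le_one θ) (abs_cos_le_one θ) hθ)
      (stab (-cos θ) (sin θ) θ (by rw [abs_neg]; exact abs_cos_le_one θ) (abs_sin_le_one θ) hθ)
      (Iop_rb_le hd1 (abs_sin_le_one θ) (abs_cos_le_one θ) hθ)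
      (by linarith [hRd θ]) (a1'_le hη hd hM θ)
    rw [← A1_rb hd1 cd hθ]
    exact h)
  have e1 := intervalIntegral.integral_add hG hii
  rw [e0, add_zero] at e1
  have e2 : (∫ θ in (0:ℝ)..π, (Pc L δ * (2 * CK * w θ ^ 2 + E) + Nc L δ M η * w θ ^ 2)) = Cfin L δ M η * E := by
    have : (fun θ => Pc L δ * (2 * CK * w θ ^ 2 + E) + Nc L δ M η * w θ ^ 2) =
      fun θ => (Pc L δ * (2 * CK) + Nc L δ M η) * w θ ^ 2 + Pc L δ * E := by funext θ; ring
    rw [this, intervalIntegral.integral_add (iw.const_mul _) (intervalIntegrable_const),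
      intervalIntegral.integral_const_mul, intervalIntegral.integral_const, ← hE, Cfin]
    simp; ring
  rw [e2] at key
  rw [← e1]
  exact key

lemma Iop_le {a b θ L : ℝ} {g : ℝ → ℝ} (ha : |a| ≤ 1) (hb : |b| ≤ 1)
    (e1 : ∀ t ∈ Icc 0 π, |g t| ≤ L) (e2 : ∀ t, |deriv g t| ≤ L) :
    |Iop g a b θ| ≤ (2 * L * L * 2 * π) * (2 * π) := by
  have hp := pi_pos
  rw [Iop_Hh]
  have := intervalIntegral.norm_integral_le_of_norm_le_const (a := 0) (b := 2 * π)
    (C := 2 * L * L * 2 * π) (f := fun φ => ∫ t in (0:ℝ)..π, Hh a (b * cos φ) φ θ g (deriv g) t) (by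
      intro φ _
      have := intervalIntegral.norm_integral_le_of_norm_le_const (a := 0) (b := π)
        (C := 2 * L * L * 2) (f := fun t => Hh a (b * cos φ) φ θ g (deriv g) t) (by
          intro t ht
          rw [uIoc_of_le hp.le] at ht
          refine Hh_le ha ?_ (e1 t (Ioc_subset_Icc_self ht)) (e2 t)
          rw [abs_mul]
          exact mul_le_one₀ hb (abs_nonneg _) (abs_cos_le_one φ))
      rwa [sub_zero, abs_of_pos hp] at this)
  rwa [sub_zero, abs_of_pos (by positivity : 0 < 2 * π)] at this

lemma rb_joint {d : ℝ → ℝ} (hd : Continuous d) : Continuous (fun p : ℝ × ℝ => rb (d p.1) p.2) := by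
  unfold rb; fun_prop

lemma uniq {s δ : ℝ} (hs : 0 < s) {cdot d : ℝ → ℝ} (hcd : Continuous cdot)
    (hd : ∀ t, HasDerivAt d (cdot t + 4 / 15) t) (hd0 : d 0 = 0) (hd1 : ∀ t ∈ Icc 0 s, |d t| < 1)
    {ρ : ℝ → ℝ → ℝ} {K : NNReal} (hρ : Continuous (fun p : ℝ × ℝ => ρ p.1 p.2))
    (hK : ∀ t, LipschitzWith K (ρ t)) (hδ : 0 < δ) (hpos : ∀ t θ, δ ≤ ρ t θ)
    (h0 : ∀ θ, ρ 0 θ = 1)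
    (heq : ∀ t ∈ Ioo 0 s, ∀ θ ∈ Ioo (0:ℝ) π, HasDerivAt (fun τ => ρ τ θ)
        (A2op (ρ t) (cdot t) θ - A1op (ρ t) (cdot t) θ * deriv (ρ t) θ) t) :
    ∀ t ∈ Icc 0 s, ∀ θ ∈ Icc 0 π, ρ t θ = rb (d t) θ := by
  have hp := pi_pos
  have hdc : Continuous d := continuous_iff_continuousAt.2 fun t => (hd t).continuousAt
  -- constants
  obtain ⟨η, hη, hηd⟩ : ∃ η > 0, ∀ t ∈ Icc 0 s, η ≤ 1 - d t ^ 2 := by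
    obtain ⟨t0, ht0, hm⟩ := isCompact_Icc.exists_isMinOn (nonempty_Icc.2 hs.le)
      (f := fun t => 1 - d t ^ 2) (by fun_prop)
    refine ⟨1 - d t0 ^ 2, ?_, fun t ht => hm ht⟩
    have := (sq_lt_one_iff_abs_lt_one _).2 (hd1 t0 ht0)
    linarith
  obtain ⟨M, hM⟩ := (isCompact_Icc (a := (0:ℝ)) (b := s)).exists_bound_of_continuousOn hcd.continuousOn
  obtain ⟨B, hB⟩ := ((isCompact_Icc (a := (0:ℝ)) (b := s)).prod
    (isCompact_Icc (a := (0:ℝ)) (b := π))).exists_bound_of_continuousOn hρ.continuousOn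
  have hB' : ∀ t ∈ Icc 0 s, ∀ θ ∈ Icc 0 π, |ρ t θ| ≤ B := fun t ht θ hθ => hB (t, θ) ⟨ht, hθ⟩
  have hM0 : 0 ≤ M := (norm_nonneg _).trans (hM 0 ⟨le_rfl, hs.le⟩)
  have hB0 : 0 ≤ B := (norm_nonneg _).trans (hB (0, 0) ⟨⟨le_rfl, hs.le⟩, ⟨le_rfl, hp.le⟩⟩)
  have hK0 : (0:ℝ) ≤ K := K.2
  have hη2 : 0 < 2 / η := by positivity
  set L := 2 / η + K + B + 2 with hL
  set δ' := min δ (η / 2) with hδ'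
  have hδ'0 : 0 < δ' := lt_min hδ (by positivity)
  set F : ℝ → ℝ → ℝ := fun t θ => (ρ t θ - rb (d t) θ) ^ 2 with hF
  set F' : ℝ → ℝ → ℝ := fun t θ => 2 * (ρ t θ - rb (d t) θ) *
    (A2op (ρ t) (cdot t) θ - A1op (ρ t) (cdot t) θ * deriv (ρ t) θ -
      (cdot t + 4 / 15) * (-cos θ - d t * sin θ ^ 2 / Sd (d t) θ)) with hF'
  have hrbj := rb_joint hdc
  have hFc : Continuous (Function.uncurry F) := (hρ.sub hrbj).pow 2
  have hFct : ∀ t, Continuous (F t) := fun t => hFc.comp (by fun_prop : Continuous fun θ => (t, θ))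
  set E : ℝ → ℝ := fun t => ∫ θ in (0:ℝ)..π, F t θ with hE
  have hEc : Continuous E :=
    intervalIntegral.continuous_parametric_intervalIntegral_of_continuous' hFc 0 π
  have hFd : ∀ t ∈ Ioo 0 s, ∀ θ ∈ Ioo 0 π, HasDerivAt (fun τ => F τ θ) (F' t θ) t := by
    intro t ht θ hθ
    refine (((heq t ht θ hθ).fun_sub (rb_dt (hd1 t (Ioo_subset_Icc_self ht)) (hd t) θ)).fun_pow 2).congr_deriv ?_
    simp only [hF']; push_cast; ring
  have hae : ∀ᵐ θ ∂(volume.restrict (uIoc 0 π)), θ ∈ Ioo 0 π := by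
    rw [uIoc_of_le hp.le, ← restrict_Ioo_eq_restrict_Ioc]
    exact ae_restrict_mem measurableSet_Ioo
  have hae' : ∀ᵐ θ : ℝ, θ ∈ uIoc 0 π → θ ∈ Ioo 0 π := (ae_restrict_iff' measurableSet_uIoc).1 hae
  set I0 := (2 * L * L * 2 * π) * (2 * π) with hI0
  have hI00 : 0 ≤ I0 := by
    have : 0 ≤ L := by positivity
    positivity
  set Bd := 2 * (B + 2) * ((1 / (8 * π) * I0 + M) + (1 / (8 * π * δ) * I0 + M / δ) * K +
      (M + 4 / 15) * (1 + 1 / η)) with hBd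
  have hbound : ∀ t ∈ Ioo 0 s, ∀ θ ∈ Ioo 0 π, |F' t θ| ≤ Bd := by
    intro t ht θ hθ
    have htc := Ioo_subset_Icc_self ht
    have hθc := Ioo_subset_Icc_self hθ
    have hdt := hd1 t htc
    have hc : |cdot t| ≤ M := hM t htc
    have hRd : ∀ x, |deriv (ρ t) x| ≤ K := fun x => norm_deriv_le_of_lipschitz (hK t)
    have hpt := hδ.trans_le (hpos t θ)
    have hII : ∀ a b, |a| ≤ 1 → |b| ≤ 1 → |Iop (ρ t) a b θ| ≤ I0 := fun a b ha hb =>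
      Iop_le ha hb (fun x hx => by linarith [hB' t htc x hx]) (fun x => by linarith [hRd x])
    have hsn := abs_sin_le_one θ
    have hcs := abs_cos_le_one θ
    have q1 : |ρ t θ - rb (d t) θ| ≤ B + 2 := by
      refine (abs_sub _ _).trans (add_le_add (hB' t htc θ hθc) ?_)
      rw [abs_of_pos (rb_pos hdt θ)]; exact rb_le hdt θ
    have q2 : |A2op (ρ t) (cdot t) θ| ≤ 1 / (8 * π) * I0 + M := by
      rw [A2_eq]
      refine (abs_sub _ _).trans (add_le_add ?_ ?_)
      · rw [abs_mul, abs_neg, abs_of_pos (by positivity : 0 < 1 / (8 * π))]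
        gcongr
        exact hII _ _ (by rwa [abs_neg]) hsn
      · rw [abs_mul]
        calc |cdot t| * |cos θ| ≤ M * 1 := by gcongr
          _ = M := mul_one _
    have q3 : |A1op (ρ t) (cdot t) θ| ≤ 1 / (8 * π * δ) * I0 + M / δ := by
      rw [A1_eq]
      refine (abs_add_le _ _).trans (add_le_add ?_ ?_)
      · rw [abs_mul, abs_neg, abs_of_pos (by positivity : 0 < 1 / (8 * π * ρ t θ))]
        gcongr
        · exact hpos t θ
        · exact hII _ _ hsn hcs
      · rw [abs_div, abs_mul, abs_of_pos hpt]
        gcongr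
        · calc |cdot t| * |sin θ| ≤ M * 1 := by gcongr
            _ = M := mul_one _
        · exact hpos t θ
    have q4 : |(cdot t + 4 / 15) * (-cos θ - d t * sin θ ^ 2 / Sd (d t) θ)| ≤ (M + 4 / 15) * (1 + 1 / η) := by
      rw [abs_mul]
      gcongr
      · refine (abs_add_le _ _).trans (add_le_add hc (by norm_num [abs_of_pos]))
      · refine (abs_sub _ _).trans (add_le_add (by rwa [abs_neg]) ?_)
        rw [abs_div, abs_mul, abs_of_pos (Sd_pos hdt θ), abs_of_nonneg (sq_nonneg (sin θ))]
        gcongr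
        · exact mul_le_one₀ hdt.le (sq_nonneg _) (sin_sq_le_one θ)
        · exact Sd_ge hη (hηd t htc) θ
    simp only [hF']
    rw [abs_mul, abs_mul, abs_two]
    have q5 : |A2op (ρ t) (cdot t) θ - A1op (ρ t) (cdot t) θ * deriv (ρ t) θ -
      (cdot t + 4 / 15) * (-cos θ - d t * sin θ ^ 2 / Sd (d t) θ)| ≤ (1 / (8 * π) * I0 + M) + (1 / (8 * π * δ) * I0 + M / δ) * K +
      (M + 4 / 15) * (1 + 1 / η) := by
      refine (abs_sub _ _).trans (add_le_add ((abs_sub _ _).trans (add_le_add q2 ?_)) q4)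
      rw [abs_mul]
      have := (abs_nonneg _).trans q3
      gcongr
      exact hRd θ
    have := (abs_nonneg _).trans q1
    rw [hBd]
    exact mul_le_mul (mul_le_mul_of_nonneg_left q1 (by norm_num)) q5 (abs_nonneg _) (by linarith)
  have hED : ∀ t ∈ Ioo 0 s, IntervalIntegrable (F' t) volume 0 π ∧
      HasDerivAt E (∫ θ in (0:ℝ)..π, F' t θ) t := by
    intro t ht
    refine intervalIntegral.hasDerivAt_integral_of_dominated_loc_of_deriv_le (s := Ioo 0 s)
      (bound := fun _ => Bd) (Ioo_mem_nhds ht.1 ht.2) (Eventually.of_forall fun τ => (hFct τ).aestronglyMeasurable)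
      ((hFct t).intervalIntegrable _ _) ?_ ?_ intervalIntegrable_const ?_
    · refine aestronglyMeasurable_of_tendsto_ae (nhdsWithin t {t}ᶜ)
        (f := fun τ θ => slope (fun x => F x θ) t τ) (fun τ => ?_) ?_
      · simp only [slope_def_field]
        exact (((hFct τ).sub (hFct t)).div_const _).aestronglyMeasurable
      · filter_upwards [hae] with θ hθ
        exact (hFd t ht θ hθ).tendsto_slope
    · filter_upwards [hae'] with θ h hθ τ hτ
      exact hbound τ hτ θ (h hθ)
    · filter_upwards [hae'] with θ h hθ τ hτ
      exact hFd τ hτ θ (h hθ)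
  set C := Cfin L δ' M η with hC
  have hEi : ∀ t ∈ Ioo 0 s, (∫ θ in (0:ℝ)..π, F' t θ) ≤ C * E t := by
    intro t ht
    have htc := Ioo_subset_Icc_self ht
    exact energy_ineq (hK t) hη (hηd t htc) (hM t htc) hδ'0 (min_le_right _ _)
      (fun x _ => (min_le_left _ _).trans (hpos t x)) (by linarith)
      (fun x hx => by linarith [hB' t htc x hx]) (hED t ht).1
  have hE0 : E 0 = 0 := by
    simp only [hE, hF, hd0, h0]
    simp [rb]
  have hg : AntitoneOn (fun t => exp (-C * t) * E t) (Icc 0 s) := by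
    have hgd : ∀ t ∈ Ioo 0 s, HasDerivAt (fun t => exp (-C * t) * E t)
        (exp (-C * t) * ((∫ θ in (0:ℝ)..π, F' t θ) - C * E t)) t := by
      intro t ht
      refine ((((hasDerivAt_id t).const_mul (-C)).exp).fun_mul (hED t ht).2).congr_deriv ?_
      simp; ring
    apply antitoneOn_of_deriv_nonpos (convex_Icc 0 s) (by fun_prop)
    · rw [interior_Icc]
      exact fun t ht => (hgd t ht).differentiableAt.differentiableWithinAt
    · rw [interior_Icc]
      intro t ht
      rw [(hgd t ht).deriv]
      exact mul_nonpos_of_nonneg_of_nonpos (exp_pos _).le (by linarith [hEi t ht])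
  intro t ht θ hθ
  have h1 := hg ⟨le_rfl, hs.le⟩ ht ht.1
  simp only [hE0, mul_zero] at h1
  have h2 : E t ≤ 0 := by
    by_contra h
    push Not at h
    have := mul_pos (exp_pos (-C * t)) h
    linarith
  by_contra hne
  have : 0 < E t := intervalIntegral.integral_pos hp (hFct t).continuousOn (fun x _ => sq_nonneg _)
    ⟨θ, hθ, by have := sub_ne_zero.2 hne; simp only [hF]; positivity⟩
  linarith

lemma deriv_congr_Ioo {f g : ℝ → ℝ} (h : EqOn f g (Icc 0 π)) {θ : ℝ} (hθ : θ ∈ Ioo 0 π) :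
    deriv f θ = deriv g θ := by
  apply Filter.EventuallyEq.deriv_eq
  filter_upwards [Ioo_mem_nhds hθ.1 hθ.2] with x hx
  exact h (Ioo_subset_Icc_self hx)

lemma Iop_congr {f g : ℝ → ℝ} (h : EqOn f g (Icc 0 π)) (a b : ℝ) {θ : ℝ} (hθ : θ ∈ Ioo 0 π) :
    Iop f a b θ = Iop g a b θ := by
  unfold Iop
  apply intervalIntegral.integral_congr; intro φ _
  beta_reduce
  rw [intervalIntegral.integral_of_le pi_pos.le, intervalIntegral.integral_of_le pi_pos.le,
    integral_Ioc_eq_integral_Ioo, integral_Ioc_eq_integral_Ioo]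
  apply setIntegral_congr_fun measurableSet_Ioo
  intro t ht
  simp only [betaR, h (Ioo_subset_Icc_self ht), h (Ioo_subset_Icc_self hθ), deriv_congr_Ioo h ht]

lemma rhs_congr {f g : ℝ → ℝ} (h : EqOn f g (Icc 0 π)) (c : ℝ) {θ : ℝ} (hθ : θ ∈ Ioo 0 π) :
    A2op f c θ - A1op f c θ * deriv f θ = A2op g c θ - A1op g c θ * deriv g θ := by
  rw [A2_eq, A1_eq, A2_eq, A1_eq, Iop_congr h _ _ hθ, Iop_congr h _ _ hθ, deriv_congr_Ioo h hθ,
    h (Ioo_subset_Icc_self hθ)]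

lemma solve {T : ℝ} (hT : 0 < T) {cdot d : ℝ → ℝ} (hcd : Continuous cdot)
    (hd : ∀ t, HasDerivAt d (cdot t + 4 / 15) t) (hd0 : d 0 = 0)
    (r : ℝ → ℝ → ℝ) (K : NNReal)
    (hr0 : ∀ θ ∈ Icc (0:ℝ) π, r 0 θ = 1)
    (hLip : ∀ t ∈ Icc 0 T, LipschitzOnWith K (r t) (Icc 0 π))
    (hpos : ∃ δ > 0, ∀ t ∈ Icc 0 T, ∀ θ ∈ Icc (0:ℝ) π, δ ≤ r t θ)
    (hcont : ContinuousOn (fun p : ℝ × ℝ => r p.1 p.2) (Icc 0 T ×ˢ Icc 0 π))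
    (heq : ∀ t ∈ Icc 0 T, ∀ θ ∈ Ioo (0:ℝ) π,
      HasDerivAt (fun τ => r τ θ)
        (A2op (r t) (cdot t) θ - A1op (r t) (cdot t) θ * deriv (r t) θ) t) :
    ∀ t ∈ Icc 0 T, |d t| < 1 ∧ ∀ θ ∈ Icc 0 π, r t θ = rb (d t) θ := by
  obtain ⟨δ, hδ, hpos⟩ := hpos
  have hp := pi_pos
  have hdc : Continuous d := continuous_iff_continuousAt.2 fun t => (hd t).continuousAt
  set ρ : ℝ → ℝ → ℝ := fun t θ => r (projIcc 0 T hT.le t) (projIcc 0 π hp.le θ) with hρ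
  have hρe : ∀ t ∈ Icc 0 T, EqOn (r t) (ρ t) (Icc 0 π) := by
    intro t ht θ hθ
    simp only [hρ, projIcc_of_mem hT.le ht, projIcc_of_mem hp.le hθ]
  have hρc : Continuous (fun p : ℝ × ℝ => ρ p.1 p.2) := by
    have : Continuous (fun p : ℝ × ℝ => ((projIcc 0 T hT.le p.1 : ℝ), (projIcc 0 π hp.le p.2 : ℝ))) := by
      have h1 : Continuous (projIcc 0 T hT.le) := continuous_projIcc
      have h2 : Continuous (projIcc 0 π hp.le) := continuous_projIcc
      fun_prop
    exact hcont.comp_continuous this fun p => ⟨Subtype.coe_prop _, Subtype.coe_prop _⟩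
  have hρK : ∀ t, LipschitzWith K (ρ t) := by
    intro t
    have h := (hLip _ (projIcc 0 T hT.le t).2)
    have h2 := LipschitzOnWith.to_restrict h
    have h3 := h2.comp (LipschitzWith.projIcc hp.le)
    rwa [mul_one] at h3
  have hρp : ∀ t θ, δ ≤ ρ t θ := fun t θ => hpos _ (Subtype.coe_prop _) _ (Subtype.coe_prop _)
  have hρ0 : ∀ θ, ρ 0 θ = 1 := fun θ => by
    have : (projIcc 0 T hT.le 0 : ℝ) = 0 := by rw [projIcc_of_mem hT.le ⟨le_rfl, hT.le⟩]
    simp only [hρ, this]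
    exact hr0 _ (Subtype.coe_prop _)
  have hρeq : ∀ t ∈ Ioo 0 T, ∀ θ ∈ Ioo (0:ℝ) π, HasDerivAt (fun τ => ρ τ θ)
        (A2op (ρ t) (cdot t) θ - A1op (ρ t) (cdot t) θ * deriv (ρ t) θ) t := by
    intro t ht θ hθ
    have h := heq t (Ioo_subset_Icc_self ht) θ hθ
    rw [rhs_congr (hρe t (Ioo_subset_Icc_self ht)) _ hθ] at h
    refine h.congr_of_eventuallyEq ?_
    filter_upwards [Ioo_mem_nhds ht.1 ht.2] with τ hτ
    exact (hρe τ (Ioo_subset_Icc_self hτ) (Ioo_subset_Icc_self hθ)).symm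
  have main : ∀ s, 0 < s → s ≤ T → (∀ t ∈ Icc 0 s, |d t| < 1) →
      ∀ t ∈ Icc 0 s, ∀ θ ∈ Icc 0 π, ρ t θ = rb (d t) θ := fun s hs hsT hds =>
    uniq hs hcd hd hd0 hds hρc hρK hδ hρp hρ0 fun t ht => hρeq t ⟨ht.1, ht.2.trans_le hsT⟩
  have hlt : ∀ t ∈ Icc 0 T, |d t| < 1 := by
    by_contra hcon
    push Not at hcon
    have hcpt : IsCompact (Icc 0 T ∩ {t | 1 ≤ |d t|}) :=
      isCompact_Icc.inter_right (isClosed_le continuous_const hdc.abs)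
    obtain ⟨t0, ⟨ht0, ht0'⟩, hmin⟩ := hcpt.exists_isLeast (by
      obtain ⟨x, hx, hx'⟩ := hcon; exact ⟨x, hx, hx'⟩)
    have ht0' : 1 ≤ |d t0| := ht0'
    have ht0p : 0 < t0 := by
      rcases ht0.1.lt_or_eq with h | h
      · exact h
      · rw [← h, hd0] at ht0'; norm_num at ht0'
    have hbelow : ∀ t ∈ Ico 0 t0, |d t| < 1 := by
      intro t ht
      by_contra h
      push Not at h
      exact absurd (hmin ⟨⟨ht.1, ht.2.le.trans ht0.2⟩, h⟩) (not_le.2 ht.2)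
    have hval : ∀ θ ∈ Icc 0 π, ρ t0 θ = rb (d t0) θ := by
      intro θ hθ
      have hcl : IsClosed {t | ρ t θ = rb (d t) θ} :=
        isClosed_eq (hρc.comp (by fun_prop : Continuous fun t => (t, θ)))
          ((rb_joint hdc).comp (by fun_prop : Continuous fun t => (t, θ)))
      have hsub : Ioo 0 t0 ⊆ {t | ρ t θ = rb (d t) θ} := fun t ht =>
        main t ht.1 (ht.2.le.trans ht0.2) (fun x hx => hbelow x ⟨hx.1, hx.2.trans_lt ht.2⟩) t
          ⟨ht.1.le, le_rfl⟩ θ hθ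
      have := hcl.closure_subset_iff.2 hsub
      rw [closure_Ioo ht0p.ne] at this
      exact this ⟨ht0p.le, le_rfl⟩
    have v0 := hval 0 ⟨le_rfl, hp.le⟩
    have v1 := hval π ⟨hp.le, le_rfl⟩
    have p0 := hρp t0 0
    have p1 := hρp t0 π
    simp [rb] at v0 v1
    have : |d t0| < 1 := abs_lt.2 ⟨by linarith, by linarith⟩
    linarith
  intro t ht
  refine ⟨hlt t ht, fun θ hθ => ?_⟩
  rw [hρe t ht hθ]
  exact main T hT le_rfl hlt t ht θ hθ

lemma nrm (c ρ θ φ v : ℝ) :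
    ‖c • e3 + ρ • eSph θ φ - v • e3‖ = √((ρ * sin θ) ^ 2 + (ρ * cos θ + (c - v)) ^ 2) := by
  rw [EuclideanSpace.norm_eq, Fin.sum_univ_three]
  congr 1
  simp [e3, eSph, V3, mul_pow, sq_abs]
  linear_combination (ρ * sin θ) ^ 2 * sin_sq_add_cos_sq φ

lemma sum_one {d : ℝ} (hd : |d| < 1) (θ : ℝ) :
    (rb d θ * sin θ) ^ 2 + (rb d θ * cos θ + d) ^ 2 = 1 := by
  rw [← cos_al hd, ← sin_al hd]; exact sin_sq_add_cos_sq _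

lemma root_uniq {d : ℝ} (hd : |d| < 1) {ρ θ : ℝ} (hρ : 0 < ρ)
    (h : (ρ * sin θ) ^ 2 + (ρ * cos θ + d) ^ 2 = 1) : ρ = rb d θ := by
  have h1 := rb_pos (d := -d) (by rwa [abs_neg]) θ
  have h2 : rb (-d) θ = d * cos θ + Sd d θ := by unfold rb Sd; simp
  have h3 := rb_eq (d := d) (θ := θ)
  have h4 := Sd_sq hd θ
  have h5 : (ρ - rb d θ) * (ρ + rb (-d) θ) = 0 := by
    rw [h2, h3]
    linear_combination h - h4 + (d ^ 2 - ρ ^ 2) * sin_sq_add_cos_sq θ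
  rcases mul_eq_zero.1 h5 with h | h <;> linarith

lemma sphere_param {c d v : ℝ} (hcv : c - v = d) (hd : |d| < 1) {x : EuclideanSpace ℝ (Fin 3)}
    (hx : x ∈ Metric.sphere (v • e3) 1) : ∃ θ ∈ Icc (0:ℝ) π, ∃ φ ∈ Icc (0:ℝ) (2 * π),
      x = c • e3 + rb d θ • eSph θ φ := by
  have hp := pi_pos
  rw [mem_sphere_iff_norm, EuclideanSpace.norm_eq, Fin.sum_univ_three, sqrt_eq_one] at hx
  have hx' : x 0 ^ 2 + x 1 ^ 2 + (x 2 - v) ^ 2 = 1 := by simpa [e3, V3] using hx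
  set y := x 2 - c with hy
  set ρ := √(x 0 ^ 2 + x 1 ^ 2 + y ^ 2) with hρ
  have hd2 := (sq_lt_one_iff_abs_lt_one _).2 hd
  have hyv : x 2 - v = y + d := by rw [hy, ← hcv]; ring
  rw [hyv] at hx'
  have hq : 0 < x 0 ^ 2 + x 1 ^ 2 + y ^ 2 := by
    by_contra h
    have h0 : x 0 ^ 2 = 0 := by nlinarith [sq_nonneg (x 0), sq_nonneg (x 1), sq_nonneg y]
    have h1 : x 1 ^ 2 = 0 := by nlinarith [sq_nonneg (x 0), sq_nonneg (x 1), sq_nonneg y]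
    have h2 : y = 0 := by
      have : y ^ 2 = 0 := by nlinarith [sq_nonneg (x 0), sq_nonneg (x 1), sq_nonneg y]
      exact pow_eq_zero_iff (by norm_num) |>.1 this
    rw [h0, h1, h2] at hx'
    linarith
  have hρp : 0 < ρ := sqrt_pos.2 hq
  have hρ2 : ρ ^ 2 = x 0 ^ 2 + x 1 ^ 2 + y ^ 2 := sq_sqrt hq.le
  have hyρ : |y| ≤ ρ := abs_le_sqrt (by nlinarith [sq_nonneg (x 0), sq_nonneg (x 1)])
  set z : ℂ := ⟨x 0, x 1⟩ with hz
  have hcos : ρ * cos (arccos (y / ρ)) = y := by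
    have h := abs_le.1 hyρ
    rw [cos_arccos]
    · field_simp
    · rw [le_div_iff₀ hρp]; linarith
    · rw [div_le_one hρp]; linarith
  have hsin0 : 0 ≤ sin (arccos (y / ρ)) := sin_nonneg_of_nonneg_of_le_pi (arccos_nonneg _) (arccos_le_pi _)
  have hnz : ‖z‖ ^ 2 = x 0 ^ 2 + x 1 ^ 2 := by
    rw [Complex.sq_norm, Complex.normSq_apply]; simp [hz]; ring
  have hsin : ρ * sin (arccos (y / ρ)) = ‖z‖ := by
    have h1 : (ρ * sin (arccos (y / ρ))) ^ 2 = ‖z‖ ^ 2 := by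
      have := sin_sq_add_cos_sq (arccos (y / ρ))
      have h3 : (ρ * cos (arccos (y / ρ))) ^ 2 = y ^ 2 := by rw [hcos]
      rw [hnz]
      linear_combination ρ ^ 2 * this - h3 + hρ2
    exact (pow_left_inj₀ (by positivity) (norm_nonneg _) (by norm_num)).1 h1
  obtain ⟨φ, hφ, hφc, hφs⟩ : ∃ φ ∈ Icc 0 (2 * π), cos φ = cos z.arg ∧ sin φ = sin z.arg := by
    rcases le_or_gt 0 z.arg with h | h
    · exact ⟨z.arg, ⟨h, by linarith [Complex.arg_le_pi z]⟩, rfl, rfl⟩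
    · exact ⟨z.arg + 2 * π, ⟨by linarith [Complex.neg_pi_lt_arg z], by linarith⟩, cos_add_two_pi _,
        sin_add_two_pi _⟩
  have c0 : ‖z‖ * cos φ = x 0 := by rw [hφc, Complex.norm_mul_cos_arg]
  have c1 : ‖z‖ * sin φ = x 1 := by rw [hφs, Complex.norm_mul_sin_arg]
  refine ⟨arccos (y / ρ), ⟨arccos_nonneg _, arccos_le_pi _⟩, φ, hφ, ?_⟩
  have hroot : ρ = rb d (arccos (y / ρ)) := by
    apply root_uniq hd hρp
    rw [hcos, hsin, hnz]; exact hx'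
  rw [← hroot]
  ext i
  fin_cases i
  · simp [e3, eSph, V3]
    linear_combination -c0 - cos φ * hsin
  · simp [e3, eSph, V3]
    linear_combination -c1 - sin φ * hsin
  · simp [e3, eSph, V3]
    linear_combination -hcos + hy

theorem spherical_case_general_center
    (T : ℝ) (hT : 0 < T)
    -- prescribed continuous reference-center velocity ċ₃, with ċ ≠ v*
    (cdot : ℝ → ℝ) (hcdotcont : Continuous cdot) (hcdotne : cdot ≠ fun _ => -(4 / 15))
    -- reference center c(t) = (0,0,c₃(t)) with c(0) = 0 and c₃' = ċ₃
    (c₃ : ℝ → ℝ) (hc₃ : ∀ t, c₃ t = ∫ τ in (0:ℝ)..t, cdot τ)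
    -- T is such that |c(t) − c*(t)| ≤ 1 on [0,T], where c*(t) = v*t = (0,0,−(4/15)t)
    (hdist : ∀ t ∈ Set.Icc 0 T, |c₃ t + (4 / 15) * t| ≤ 1)
    -- (r, c) solves the surface evolution equation with r(0,·) = 1
    (r : ℝ → ℝ → ℝ) (K : NNReal)
    (hr0 : ∀ θ ∈ Set.Icc (0:ℝ) π, r 0 θ = 1)
    (hLip : ∀ t ∈ Set.Icc 0 T, LipschitzOnWith K (r t) (Set.Icc 0 π))
    (hpos : ∃ δ > 0, ∀ t ∈ Set.Icc 0 T, ∀ θ ∈ Set.Icc (0:ℝ) π, δ ≤ r t θ)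
    (hcont : ContinuousOn (fun p : ℝ × ℝ => r p.1 p.2) (Set.Icc 0 T ×ˢ Set.Icc 0 π))
    (heq : ∀ t ∈ Set.Icc 0 T, ∀ θ ∈ Set.Ioo (0:ℝ) π,
      HasDerivAt (fun τ => r τ θ)
        (A2op (r t) (cdot t) θ - A1op (r t) (cdot t) θ * deriv (r t) θ) t) :
    (∀ t ∈ Set.Icc 0 T, ∀ θ ∈ Set.Icc (0:ℝ) π,
      r t θ = -(c₃ t + (4 / 15) * t) * Real.cos θ +
          Real.sqrt (1 - (c₃ t + (4 / 15) * t) ^ 2 * Real.sin θ ^ 2) ∧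
      ‖c₃ t • e3 + r t θ • eSph θ 0 - (-(4 / 15) * t) • e3‖ = 1) ∧
    -- the droplet boundary is the Hadamard–Rybczynski sphere ∂B(c*(t),1)
    (∀ t ∈ Set.Icc 0 T,
      {x : EuclideanSpace ℝ (Fin 3) | ∃ θ ∈ Set.Icc (0:ℝ) π, ∃ φ ∈ Set.Icc (0:ℝ) (2 * π),
          x = c₃ t • e3 + r t θ • eSph θ φ}
        = Metric.sphere ((-(4 / 15) * t) • e3) 1) := by
  have hdd : ∀ t, HasDerivAt (fun t => c₃ t + (4 / 15) * t) (cdot t + 4 / 15) t := by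
    intro t
    have h1 : HasDerivAt c₃ (cdot t) t := by
      rw [show c₃ = fun t => ∫ τ in (0:ℝ)..t, cdot τ from funext hc₃]
      exact intervalIntegral.integral_hasDerivAt_right (hcdotcont.intervalIntegrable _ _)
        (hcdotcont.stronglyMeasurableAtFilter _ _) hcdotcont.continuousAt
    exact (h1.fun_add ((hasDerivAt_id t).const_mul (4 / 15))).congr_deriv (by simp)
  have hd0 : (fun t => c₃ t + (4 / 15) * t) 0 = 0 := by simp [hc₃]
  have hsol := solve hT hcdotcont hdd hd0 r K hr0 hLip hpos hcont heq
  have hcv : ∀ t, c₃ t - (-(4 / 15) * t) = c₃ t + (4 / 15) * t := fun t => by ring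
  refine ⟨fun t ht θ hθ => ?_, fun t ht => ?_⟩
  · obtain ⟨h1, h2⟩ := hsol t ht
    refine ⟨h2 θ hθ, ?_⟩
    rw [nrm, hcv, h2 θ hθ, sum_one h1, sqrt_one]
  · obtain ⟨h1, h2⟩ := hsol t ht
    ext x
    constructor
    · rintro ⟨θ, hθ, φ, hφ, rfl⟩
      rw [mem_sphere_iff_norm, nrm, hcv, h2 θ hθ, sum_one h1, sqrt_one]
    · intro hx
      obtain ⟨θ, hθ, φ, hφ, h⟩ := sphere_param (hcv t) h1 hx
      exact ⟨θ, hθ, φ, hφ, by rw [h2 θ hθ]; exact h⟩
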